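/- Let N ≥ 3. If (u_k) is a sequence in C²_c(ℝ^N) that is Cauchy with respect to the Besov norm ‖·‖_{2−2/N, N}, then for every φ ∈ C²_c(ℝ^N) the sequence of real numbers (∫_{ℝ^N} det(D²u_k) φ dx) converges. -/

import Mathlib

open MeasureTheory Real Filter

noncomputable section

abbrev Eu (N : ℕ) : Type := EuclideanSpace ℝ (Fin N)

def ebasis {N : ℕ} (i : Fin N) : Eu N := EuclideanSpace.single i 1

/-- Partial derivative `∂ᵢ u (x)`. -/
def pd {N : ℕ} (u : Eu N → ℝ) (i : Fin N) (x : Eu N) : ℝ :=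
  fderiv ℝ u x (ebasis i)

/-- Second partial derivative `∂ᵢ∂ⱼ u (x)`. -/
def pd2 {N : ℕ} (u : Eu N → ℝ) (i j : Fin N) (x : Eu N) : ℝ :=
  fderiv ℝ (fun y => fderiv ℝ u y (ebasis j)) x (ebasis i)

/-- The determinant of the Hessian matrix `det (D²u)(x)`. -/
def hessDet {N : ℕ} (u : Eu N → ℝ) (x : Eu N) : ℝ :=
  (Matrix.of fun i j => pd2 u i j x).det

/-- The Besov norm `‖u‖_{s,p}`. -/
def besov (N : ℕ) (s p : ℝ) (u : Eu N → ℝ) : ℝ :=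
  (∫ x : Eu N, |u x| ^ p) ^ (1/p)
  + (∫ x : Eu N, ‖fderiv ℝ u x‖ ^ p) ^ (1/p)
  + (∫ x : Eu N, ∫ y : Eu N,
      ‖fderiv ℝ u x - fderiv ℝ u y‖ ^ p / ‖x - y‖ ^ ((N : ℝ) + (s-1)*p)) ^ (1/p)

section part1

open MeasureTheory Real Filter

lemma det_row {n : ℕ} (M : Matrix (Fin n) (Fin n) ℝ) :
    M.det = ∑ σ : Equiv.Perm (Fin n), ((Equiv.Perm.sign σ : ℤ) : ℝ) * ∏ l, M l (σ l) := by
  rw [← Matrix.det_transpose, Matrix.det_apply']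
  rfl

lemma prod_updateRow {n : ℕ} (M : Matrix (Fin n) (Fin n) ℝ) (i : Fin n) (b : Fin n → ℝ)
    (σ : Fin n → Fin n) :
    ∏ l, M.updateRow i b l (σ l) = b (σ i) * ∏ l ∈ Finset.univ.erase i, M l (σ l) := by
  rw [← Finset.mul_prod_erase Finset.univ _ (Finset.mem_univ i)]
  congr 1
  · simp
  · apply Finset.prod_congr rfl
    intro l hl
    rw [Matrix.updateRow_ne (Finset.ne_of_mem_erase hl)]

lemma hasDerivAt_det {n : ℕ} (M : ℝ → Matrix (Fin n) (Fin n) ℝ) (M' : Matrix (Fin n) (Fin n) ℝ)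
    (t : ℝ) (h : ∀ i j, HasDerivAt (fun s => M s i j) (M' i j) t) :
    HasDerivAt (fun s => (M s).det) (∑ i, ((M t).updateRow i (M' i)).det) t := by
  have : ∀ σ : Equiv.Perm (Fin n), HasDerivAt
      (fun s => ((Equiv.Perm.sign σ : ℤ) : ℝ) * ∏ l, M s l (σ l))
      (((Equiv.Perm.sign σ : ℤ) : ℝ) * ∑ i, ∏ l, (M t).updateRow i (M' i) l (σ l)) t := by
    intro σ
    have h1 := HasDerivAt.fun_finsetProd (u := Finset.univ) (x := t)
      (f := fun l s => M s l (σ l)) (f' := fun l => M' l (σ l)) (fun i _ => h i (σ i))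
    apply HasDerivAt.const_mul
    convert h1 using 1
    apply Finset.sum_congr rfl
    intro i _
    rw [prod_updateRow, smul_eq_mul, mul_comm]
  have h2 := HasDerivAt.fun_sum (u := Finset.univ) (fun σ _ => this σ)
  simp only [det_row]
  refine h2.congr_deriv ?_
  rw [Finset.sum_comm]
  simp only [Finset.mul_sum]

variable {N : ℕ}

lemma pd2_eq (u : Eu N → ℝ) (i j : Fin N) (x : Eu N) : pd2 u i j x = pd (pd u j) i x := rfl

lemma contDiff_pd {u : Eu N → ℝ} {n m : WithTop ℕ∞} (hu : ContDiff ℝ n u) (h : m + 1 ≤ n) (i : Fin N) :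
    ContDiff ℝ m (pd u i) :=
  (hu.fderiv_right h).clm_apply contDiff_const

lemma hasCompactSupport_pd {u : Eu N → ℝ} (hu : HasCompactSupport u) (i : Fin N) :
    HasCompactSupport (pd u i) := hu.fderiv_apply ℝ _

lemma pd_comm {u : Eu N → ℝ} (hu : ContDiff ℝ 2 u) (i j : Fin N) (x : Eu N) :
    pd (pd u j) i x = pd (pd u i) j x := by
  have hs := (hu.contDiffAt (x := x)).isSymmSndFDerivAt (by simp)
  have hd : DifferentiableAt ℝ (fderiv ℝ u) x :=
    ((hu.fderiv_right (m := 1) (by norm_num)).differentiable (by norm_num)) x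
  have key : ∀ a b : Eu N, fderiv ℝ (fun y => fderiv ℝ u y b) x a = fderiv ℝ (fderiv ℝ u) x a b := by
    intro a b
    rw [fderiv_clm_apply hd (differentiableAt_const _)]
    simp
  unfold pd
  rw [key, key]
  exact hs _ _

/-- Jacobian determinant. -/
def JD (f : Fin N → Eu N → ℝ) (x : Eu N) : ℝ := (Matrix.of fun i j => pd (f i) j x).det

lemma JD_update (f : Fin N → Eu N → ℝ) (i : Fin N) (g : Eu N → ℝ) (x : Eu N) :
    JD (Function.update f i g) x =
      ((Matrix.of fun i j => pd (f i) j x).updateRow i (fun j => pd g j x)).det := by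
  unfold JD
  congr 1
  ext a b
  by_cases h : a = i
  · subst h; simp
  · simp [h, Matrix.updateRow_ne]

lemma continuous_det_of {X : Type*} [TopologicalSpace X] {n : ℕ} {M : X → Matrix (Fin n) (Fin n) ℝ}
    (h : ∀ i j, Continuous fun x => M x i j) : Continuous fun x => (M x).det := by
  apply Continuous.matrix_det
  exact continuous_matrix h

lemma perm_sum_zero {n : ℕ} (i k : Fin n) (hik : k ≠ i) (A : Fin n → Fin n → ℝ)
    (B : Fin n → Fin n → ℝ) (hB : ∀ a b, B a b = B b a) :
    ∑ σ : Equiv.Perm (Fin n), ((Equiv.Perm.sign σ : ℤ) : ℝ) *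
      ((∏ l ∈ (Finset.univ.erase i).erase k, A l (σ l)) * B (σ i) (σ k)) = 0 := by
  have e := Equiv.sum_comp (Equiv.mulRight (Equiv.swap i k)) (fun σ : Equiv.Perm (Fin n) =>
     ((Equiv.Perm.sign σ : ℤ) : ℝ) *
      ((∏ l ∈ (Finset.univ.erase i).erase k, A l (σ l)) * B (σ i) (σ k)))
  have e2 : ∀ σ : Equiv.Perm (Fin n), ((Equiv.Perm.sign (Equiv.mulRight (Equiv.swap i k) σ) : ℤ) : ℝ) *
      ((∏ l ∈ (Finset.univ.erase i).erase k, A l (Equiv.mulRight (Equiv.swap i k) σ l)) *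
        B (Equiv.mulRight (Equiv.swap i k) σ i) (Equiv.mulRight (Equiv.swap i k) σ k)) = 
      - (((Equiv.Perm.sign σ : ℤ) : ℝ) *
      ((∏ l ∈ (Finset.univ.erase i).erase k, A l (σ l)) * B (σ i) (σ k))) := by
    intro σ
    have : ∏ l ∈ (Finset.univ.erase i).erase k, A l (Equiv.mulRight (Equiv.swap i k) σ l)
       = ∏ l ∈ (Finset.univ.erase i).erase k, A l (σ l) := by
      apply Finset.prod_congr rfl
      intro l hl
      simp only [Finset.mem_erase, Finset.mem_univ] at hl
      simp [Equiv.swap_apply_of_ne_of_ne hl.2.1 hl.1]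
    rw [this, Equiv.coe_mulRight, Equiv.Perm.sign_mul, Equiv.Perm.sign_swap hik.symm]
    simp only [Equiv.Perm.mul_apply, Equiv.swap_apply_left, Equiv.swap_apply_right]
    rw [hB (σ k) (σ i)]
    push_cast
    ring
  simp only [e2, Finset.sum_neg_distrib] at e
  linarith

/-- Null Lagrangian. -/
lemma integral_JD_eq_zero (f : Fin N → Eu N → ℝ) (i : Fin N)
    (hi : ContDiff ℝ 1 (f i)) (hc : HasCompactSupport (f i))
    (hf : ∀ k, k ≠ i → ContDiff ℝ 2 (f k)) : ∫ x, JD f x = 0 := by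
  set G : Equiv.Perm (Fin N) → Eu N → ℝ := fun σ x =>
    ∏ l ∈ Finset.univ.erase i, pd (f l) (σ l) x with hG
  have hpd : ∀ k, k ≠ i → ∀ j, ContDiff ℝ 1 (pd (f k) j) := fun k hk j =>
    contDiff_pd (hf k hk) (by norm_num) j
  have hGc : ∀ σ, ContDiff ℝ 1 (G σ) := by
    intro σ
    apply contDiff_prod
    intro l hl
    exact hpd l (Finset.ne_of_mem_erase hl) _
  have hpi : ∀ j, Continuous (pd (f i) j) := fun j =>
    (contDiff_pd (m := 0) hi (by norm_num) j).continuous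
  have hGf : ∀ σ j, Continuous (fun x => fderiv ℝ (G σ) x (ebasis j)) := fun σ j =>
    (contDiff_pd (m := 0) (hGc σ) (by norm_num) j).continuous
  have ibp : ∀ σ : Equiv.Perm (Fin N), ∫ x, f i x * fderiv ℝ (G σ) x (ebasis (σ i)) = 
      - ∫ x, fderiv ℝ (f i) x (ebasis (σ i)) * G σ x := by
    intro σ
    apply integral_mul_fderiv_eq_neg_fderiv_mul_of_integrable
    · exact ((hpi _).mul (hGc σ).continuous).integrable_of_hasCompactSupport
        ((hasCompactSupport_pd hc _).mul_right)
    · exact (hi.continuous.mul (hGf σ _)).integrable_of_hasCompactSupport hc.mul_right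
    · exact (hi.continuous.mul (hGc σ).continuous).integrable_of_hasCompactSupport hc.mul_right
    · intro x _; exact (hi.differentiable (by norm_num)) x
    · intro x _; exact ((hGc σ).differentiable (by norm_num)) x
  have hz : ∀ x, ∑ σ : Equiv.Perm (Fin N), ((Equiv.Perm.sign σ : ℤ) : ℝ) *
      (f i x * fderiv ℝ (G σ) x (ebasis (σ i))) = 0 := by
    intro x
    have hfd : ∀ σ : Equiv.Perm (Fin N), fderiv ℝ (G σ) x (ebasis (σ i)) = 
       ∑ k ∈ Finset.univ.erase i, (∏ l ∈ (Finset.univ.erase i).erase k, pd (f l) (σ l) x) *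
         pd (pd (f k) (σ k)) (σ i) x := by
      intro σ
      have := HasFDerivAt.finsetProd (u := Finset.univ.erase i) (x := x)
        (g := fun l => pd (f l) (σ l)) (g' := fun l => fderiv ℝ (pd (f l) (σ l)) x)
        (fun l hl => (((hpd l (Finset.ne_of_mem_erase hl) (σ l)).differentiable (by norm_num)) x).hasFDerivAt)
      have h2 : HasFDerivAt (G σ) _ x := this.congr_of_eventuallyEq (Eventually.of_forall (fun y => by
        simp [hG]))
      rw [h2.fderiv]
      simp [pd]
    simp only [hfd]
    have : ∀ k ∈ Finset.univ.erase i, ∑ σ : Equiv.Perm (Fin N), ((Equiv.Perm.sign σ : ℤ) : ℝ) *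
        (f i x * ((∏ l ∈ (Finset.univ.erase i).erase k, pd (f l) (σ l) x) *
         pd (pd (f k) (σ k)) (σ i) x)) = 0 := by
      intro k hk
      have hk' := Finset.ne_of_mem_erase hk
      have := perm_sum_zero i k hk' (fun l j => pd (f l) j x) (fun a b => pd (pd (f k) b) a x)
        (fun a b => pd_comm (hf k hk') a b x)
      have h3 := congrArg (fun r => f i x * r) this
      simp only [mul_zero, Finset.mul_sum] at h3
      rw [← h3]
      apply Finset.sum_congr rfl
      intros; ring
    simp only [Finset.mul_sum]
    rw [Finset.sum_comm]
    exact Finset.sum_eq_zero this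
  have hJ : ∀ x, JD f x = ∑ σ : Equiv.Perm (Fin N), ((Equiv.Perm.sign σ : ℤ) : ℝ) *
      (fderiv ℝ (f i) x (ebasis (σ i)) * G σ x) := by
    intro x
    unfold JD
    rw [det_row]
    apply Finset.sum_congr rfl
    intro σ _
    congr 1
    rw [← Finset.mul_prod_erase Finset.univ _ (Finset.mem_univ i)]
    rfl
  simp only [hJ]
  rw [integral_finsetSum]
  · have : ∀ σ : Equiv.Perm (Fin N), ∫ x, ((Equiv.Perm.sign σ : ℤ) : ℝ) *
      (fderiv ℝ (f i) x (ebasis (σ i)) * G σ x) = - ∫ x, ((Equiv.Perm.sign σ : ℤ) : ℝ) *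
        (f i x * fderiv ℝ (G σ) x (ebasis (σ i))) := by
      intro σ
      rw [integral_const_mul, integral_const_mul, ibp σ]
      ring
    simp only [this, Finset.sum_neg_distrib]
    rw [← integral_finsetSum]
    · simp [hz]
    · intro σ _
      exact ((hi.continuous.mul (hGf σ _)).integrable_of_hasCompactSupport hc.mul_right).const_mul _
  · intro σ _
    exact (((hpi _).mul (hGc σ).continuous).integrable_of_hasCompactSupport
        ((hasCompactSupport_pd hc _).mul_right)).const_mul _

lemma JD_update_mul (f : Fin N → Eu N → ℝ) (i : Fin N) (a b : Eu N → ℝ) (x : Eu N)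
    (ha : DifferentiableAt ℝ a x) (hb : DifferentiableAt ℝ b x) :
    JD (Function.update f i (fun y => a y * b y)) x =
      a x * JD (Function.update f i b) x + b x * JD (Function.update f i a) x := by
  rw [JD_update, JD_update, JD_update, ← Matrix.det_updateRow_smul, ← Matrix.det_updateRow_smul,
    ← Matrix.det_updateRow_add]
  congr 2
  ext j
  unfold pd
  rw [fderiv_fun_mul ha hb]
  simp

lemma continuous_JD (f : Fin N → Eu N → ℝ) (hf : ∀ k, ContDiff ℝ 1 (f k)) : Continuous (JD f) := by
  apply continuous_det_of
  intro i j
  exact (contDiff_pd (m := 0) (hf i) (by norm_num) j).continuous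

lemma contDiff_upd {n : WithTop ℕ∞} {f : Fin N → Eu N → ℝ} {i : Fin N} {g : Eu N → ℝ}
    (hf : ∀ k, ContDiff ℝ n (f k)) (hg : ContDiff ℝ n g) (k : Fin N) :
    ContDiff ℝ n (Function.update f i g k) := by
  by_cases h : k = i
  · subst h; simpa
  · simpa [h] using hf k

/-- Integration by parts. -/
lemma integral_mul_JD (f : Fin N → Eu N → ℝ) (i : Fin N) (χ : Eu N → ℝ)
    (hχ : ContDiff ℝ 1 χ) (hc : HasCompactSupport χ) (hf : ∀ k, ContDiff ℝ 2 (f k)) :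
    ∫ x, χ x * JD f x = - ∫ x, f i x * JD (Function.update f i χ) x := by
  have hf1 : ∀ k, ContDiff ℝ 1 (f k) := fun k => (hf k).of_le (by norm_num)
  have h0 := integral_JD_eq_zero (Function.update f i (fun y => χ y * f i y)) i
    (by simpa using hχ.mul (hf1 i)) (by
      simp only [Function.update_self]; exact HasCompactSupport.mul_right (f' := f i) hc)
    (fun k hk => by simpa [hk] using hf k)
  have h1 : ∀ x, JD (Function.update f i (fun y => χ y * f i y)) x = 
     χ x * JD f x + f i x * JD (Function.update f i χ) x := by
    intro x
    rw [JD_update_mul _ _ _ _ _ (hχ.differentiable (by norm_num) x)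
      ((hf i).differentiable (by norm_num) x), Function.update_eq_self]
  simp only [h1] at h0
  rw [integral_add] at h0
  · linarith
  · exact (hχ.continuous.mul (continuous_JD f hf1)).integrable_of_hasCompactSupport hc.mul_right
  · have : (fun x => f i x * JD (Function.update f i χ) x) =
      fun x => JD (Function.update f i (fun y => χ y * f i y)) x - χ x * JD f x := by
      ext x; rw [h1]; ring
    apply Continuous.integrable_of_hasCompactSupport
    · exact (hf1 i).continuous.mul (continuous_JD _ (contDiff_upd hf1 hχ))
    · apply HasCompactSupport.mul_left
      apply hc.mono'
      intro x hx
      contrapose! hx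
      simp only [Function.mem_support, not_not]
      rw [JD_update]
      apply Matrix.det_eq_zero_of_row_eq_zero i
      intro j
      simp only [Matrix.updateRow_self]
      unfold pd
      have : χ =ᶠ[nhds x] 0 := notMem_tsupport_iff_eventuallyEq.mp hx
      rw [this.fderiv_eq]
      simp

end part1

section part2

open MeasureTheory Real Filter
open scoped ContDiff
variable {N : ℕ}

lemma two_le_inf : (2 : WithTop ℕ∞) ≤ ∞ := by
  have : ((2 : ℕ∞) : WithTop ℕ∞) ≤ ((⊤ : ℕ∞) : WithTop ℕ∞) := WithTop.coe_le_coe.2 le_top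
  exact this

/-- directional derivative on space-time -/
def dd (v : Eu N × ℝ) (f : Eu N × ℝ → ℝ) (p : Eu N × ℝ) : ℝ := fderiv ℝ f p v
def ex (i : Fin N) : Eu N × ℝ := (ebasis i, 0)
def et : Eu N × ℝ := (0, 1)
def Sm (f : Eu N × ℝ → ℝ) : Prop := ∀ p, 0 < p.2 → ContDiffAt ℝ ∞ f p

lemma Sm.dd {f : Eu N × ℝ → ℝ} (hf : Sm f) (v : Eu N × ℝ) : Sm (dd v f) := fun p hp =>
  ((hf p hp).fderiv_right (m := ∞) (by simp)).clm_apply contDiffAt_const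

lemma Sm.diff {f : Eu N × ℝ → ℝ} (hf : Sm f) {p : Eu N × ℝ} (hp : 0 < p.2) :
    DifferentiableAt ℝ f p := (hf p hp).differentiableAt (by simp)

lemma Sm.slice {f : Eu N × ℝ → ℝ} (hf : Sm f) {t : ℝ} (ht : 0 < t) :
    ContDiff ℝ ∞ (fun x => f (x, t)) := by
  rw [contDiff_iff_contDiffAt]
  intro x
  exact ContDiffAt.comp x (hf (x, t) ht) (contDiffAt_id.prodMk contDiffAt_const)

lemma Sm.pd_slice {f : Eu N × ℝ → ℝ} (hf : Sm f) {t : ℝ} (ht : 0 < t) (j : Fin N) :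
    pd (fun x => f (x, t)) j = fun x => _root_.dd (ex j) f (x, t) := by
  ext x
  have h1 : HasFDerivAt (fun x : Eu N => (x, t)) (ContinuousLinearMap.inl ℝ (Eu N) ℝ) x :=
    hasFDerivAt_prodMk_left x t
  have h2 := (hf.diff (p := (x, t)) ht).hasFDerivAt.comp x h1
  unfold pd
  have : fderiv ℝ (fun x => f (x, t)) x = _ := h2.fderiv
  rw [this]
  rfl

lemma Sm.dt_slice {f : Eu N × ℝ → ℝ} (hf : Sm f) (x : Eu N) {t : ℝ} (ht : 0 < t) :
    HasDerivAt (fun s => f (x, s)) (_root_.dd et f (x, t)) t := by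
  have h1 : HasFDerivAt (fun s : ℝ => (x, s)) (ContinuousLinearMap.inr ℝ (Eu N) ℝ) t :=
    hasFDerivAt_prodMk_right x t
  have h2 := (hf.diff (p := (x, t)) ht).hasFDerivAt.comp t h1
  have := h2.hasDerivAt
  exact this

lemma Sm.comm {f : Eu N × ℝ → ℝ} (hf : Sm f) (v w : Eu N × ℝ) {p : Eu N × ℝ} (hp : 0 < p.2) :
    _root_.dd v (_root_.dd w f) p = _root_.dd w (_root_.dd v f) p := by
  have hs := (hf p hp).isSymmSndFDerivAt (by simpa using two_le_inf)
  have hd : DifferentiableAt ℝ (fderiv ℝ f) p :=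
    (((hf p hp).fderiv_right (m := 1) (by rw [one_add_one_eq_two]; exact two_le_inf)).differentiableAt (by norm_num))
  have key : ∀ a b : Eu N × ℝ, fderiv ℝ (fun y => fderiv ℝ f y b) p a
      = fderiv ℝ (fderiv ℝ f) p a b := by
    intro a b
    rw [fderiv_clm_apply hd (differentiableAt_const _)]
    simp
  unfold _root_.dd
  rw [key, key]
  exact hs _ _

lemma Sm.continuousOn {f : Eu N × ℝ → ℝ} (hf : Sm f) : ContinuousOn f {p | 0 < p.2} :=
  fun p hp => (hf p hp).continuousAt.continuousWithinAt

/-- if two smooth functions agree for positive time so do their derivatives -/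
lemma dd_congr {f g : Eu N × ℝ → ℝ} (h : ∀ p : Eu N × ℝ, 0 < p.2 → f p = g p) (v : Eu N × ℝ)
    {p : Eu N × ℝ} (hp : 0 < p.2) : dd v f p = dd v g p := by
  have : f =ᶠ[nhds p] g := by
    have ho : IsOpen {p : Eu N × ℝ | 0 < p.2} := isOpen_lt continuous_const continuous_snd
    filter_upwards [ho.mem_nhds hp] with q hq using h q hq
  unfold dd
  rw [this.fderiv_eq]

lemma sum_swap_aux {n : ℕ} (M : Matrix (Fin n) (Fin n) ℝ) (hM : M.transpose = M) (a b : Fin n → ℝ) :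
    ∑ i, a i * (M.updateRow i b).det = ∑ i, b i * (M.updateRow i a).det := by
  have h : ∀ (c : Fin n → ℝ) i, (M.updateRow i c).det = (M.adjugate.mulVec c) i := by
    intro c i
    rw [← Matrix.det_transpose, ← Matrix.updateCol_transpose, hM, ← Matrix.cramer_apply,
      Matrix.cramer_eq_adjugate_mulVec]
  simp only [h]
  have h1 : ∑ i, a i * (M.adjugate.mulVec b) i = a ⬝ᵥ M.adjugate.mulVec b := rfl
  have h2 : ∑ i, b i * (M.adjugate.mulVec a) i = b ⬝ᵥ M.adjugate.mulVec a := rfl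
  rw [h1, h2, Matrix.dotProduct_mulVec, dotProduct_comm, ← Matrix.mulVec_transpose,
    Matrix.adjugate_transpose, hM]

lemma JD_zero_of {f : Fin N → Eu N → ℝ} {i : Fin N} {x : Eu N} (h : x ∉ tsupport (f i)) :
    JD f x = 0 := by
  apply Matrix.det_eq_zero_of_row_eq_zero i
  intro j
  simp only [Matrix.of_apply]
  unfold pd
  have : f i =ᶠ[nhds x] 0 := notMem_tsupport_iff_eventuallyEq.mp h
  rw [this.fderiv_eq]
  simp

lemma integrable_mul_JD {f : Fin N → Eu N → ℝ} {i : Fin N} {a : Eu N → ℝ} (ha : Continuous a)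
    (hf : ∀ k, ContDiff ℝ 1 (f k)) (hi : HasCompactSupport (f i)) :
    Integrable (fun x => a x * JD f x) := by
  apply Continuous.integrable_of_hasCompactSupport
  · exact ha.mul (continuous_JD f hf)
  · apply HasCompactSupport.mul_left
    apply hi.mono'
    intro x hx
    contrapose! hx
    simpa using JD_zero_of hx

lemma first_ibp (v w φ : Eu N → ℝ) (hv : ContDiff ℝ ∞ v) (hw : ContDiff ℝ ∞ w) (hφ : ContDiff ℝ 2 φ)
    (hφs : HasCompactSupport φ) :
    ∫ x, φ x * ∑ i, JD (Function.update (fun k => pd v k) i (pd w i)) x =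
      ∫ x, w x * ∑ j, JD (Function.update (fun k => pd v k) j (pd φ j)) x := by
  have hle : ∀ {f : Eu N → ℝ}, ContDiff ℝ ∞ f → ContDiff ℝ 2 f := fun h =>
    h.of_le two_le_inf
  have hle1 : ∀ {f : Eu N → ℝ}, ContDiff ℝ ∞ f → ContDiff ℝ 1 f := fun h =>
    h.of_le (by exact_mod_cast le_top)
  have hpv : ∀ k, ContDiff ℝ ∞ (pd v k) := fun k => contDiff_pd hv (by simp) k
  have hpw : ∀ k, ContDiff ℝ ∞ (pd w k) := fun k => contDiff_pd hw (by simp) k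
  have hpφ : ∀ k, ContDiff ℝ 1 (pd φ k) := fun k => contDiff_pd hφ (by norm_num) k
  have hφ1 : ContDiff ℝ 1 φ := hφ.of_le (by norm_num)
  have hφk : ∀ k, HasCompactSupport (pd φ k) := fun k => hasCompactSupport_pd hφs k
  simp only [Finset.mul_sum]
  rw [integral_finsetSum, integral_finsetSum]
  rotate_left
  · intro j _
    exact integrable_mul_JD (i := j) hw.continuous (contDiff_upd (fun k => hle1 (hpv k)) (hpφ j))
      (by simpa using hφk j)
  · intro i _
    exact (hφ.continuous.mul (continuous_JD _ (contDiff_upd (fun k => hle1 (hpv k))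
      (hle1 (hpw i))))).integrable_of_hasCompactSupport hφs.mul_right
  have e1 : ∀ i, ∫ x, φ x * JD (Function.update (fun k => pd v k) i (pd w i)) x = 
      - ∫ x, pd w i x * JD (Function.update (fun k => pd v k) i φ) x := by
    intro i
    rw [integral_mul_JD _ i φ hφ1 hφs (contDiff_upd (fun k => hle (hpv k)) (hle (hpw i)))]
    simp
  have e2 : ∀ j, ∫ x, w x * JD (Function.update (fun k => pd v k) j (pd φ j)) x =
      - ∫ x, pd φ j x * JD (Function.update (fun k => pd v k) j w) x := by
    intro i
    rw [integral_mul_JD _ i (pd φ i) (hpφ i) (hφk i) (contDiff_upd (fun k => hle (hpv k)) (hle hw))]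
    simp
  simp only [e1, e2, Finset.sum_neg_distrib]
  congr 1
  rw [← integral_finsetSum, ← integral_finsetSum]
  · congr 1
    ext x
    simp only [JD_update]
    apply sum_swap_aux
    ext i j
    exact pd_comm (hle hv) i j x
  · intro j _
    exact ((hpφ j).continuous.mul (continuous_JD _ (contDiff_upd (fun k => hle1 (hpv k))
      (hle1 hw)))).integrable_of_hasCompactSupport (hφk j).mul_right
  · intro i _
    exact integrable_mul_JD (i := i) (hpw i).continuous (contDiff_upd (fun k => hle1 (hpv k)) hφ1)
      (by simpa using hφs)

lemma second_ibp (v w φ : Eu N → ℝ) (hv : ContDiff ℝ ∞ v) (hw : ContDiff ℝ ∞ w) (hφ : ContDiff ℝ 2 φ)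
    (hφs : HasCompactSupport φ) (i j : Fin N) (hij : i ≠ j) :
    ∫ x, w x * JD (Function.update (Function.update (fun k => pd v k) j (pd φ j)) i (pd w i)) x =
      - ∫ x, pd w i x * JD (Function.update (Function.update (fun k => pd v k) j (pd φ j)) i w) x := by
  have hle : ∀ {f : Eu N → ℝ}, ContDiff ℝ ∞ f → ContDiff ℝ 2 f := fun h =>
    h.of_le two_le_inf
  have hle1 : ∀ {f : Eu N → ℝ}, ContDiff ℝ ∞ f → ContDiff ℝ 1 f := fun h =>
    h.of_le (by exact_mod_cast le_top)
  have hpv : ∀ k, ContDiff ℝ ∞ (pd v k) := fun k => contDiff_pd hv (by simp) k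
  have hpw : ∀ k, ContDiff ℝ ∞ (pd w k) := fun k => contDiff_pd hw (by simp) k
  have hpφ : ∀ k, ContDiff ℝ 1 (pd φ k) := fun k => contDiff_pd hφ (by norm_num) k
  have hφk : ∀ k, HasCompactSupport (pd φ k) := fun k => hasCompactSupport_pd hφs k
  have h0 := integral_JD_eq_zero (Function.update (Function.update (fun k => pd v k) j (pd φ j)) i
    (fun y => w y * pd w i y)) j (by simpa [hij.symm] using hpφ j) (by simpa [hij.symm] using hφk j)
    (by
      intro k hk
      by_cases h : k = i
      · subst h; simpa using (hle hw).mul (hle (hpw k))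
      · simpa [h, hk] using hle (hpv k))
  have h1 : ∀ x, JD (Function.update (Function.update (fun k => pd v k) j (pd φ j)) i
    (fun y => w y * pd w i y)) x = _ := fun x => JD_update_mul _ _ _ _ x
      ((hle hw).differentiable (by norm_num) x) ((hle (hpw i)).differentiable (by norm_num) x)
  simp only [h1] at h0
  rw [integral_add] at h0
  · linarith
  · exact integrable_mul_JD (i := j) hw.continuous (contDiff_upd (contDiff_upd (fun k => hle1 (hpv k))
      (hpφ j)) (hle1 (hpw i))) (by simpa [hij.symm] using hφk j)
  · exact integrable_mul_JD (i := j) (hpw i).continuous (contDiff_upd (contDiff_upd (fun k => hle1 (hpv k))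
      (hpφ j)) (hle1 hw)) (by simpa [hij.symm] using hφk j)

lemma hasDerivAt_int (G G' : Eu N × ℝ → ℝ) (K : Set (Eu N)) (hK : IsCompact K)
    (hG : Continuous G) (hG' : ContinuousOn G' {p | 0 < p.2})
    (hGz : ∀ x, x ∉ K → ∀ t, G (x, t) = 0) (hGz' : ∀ x, x ∉ K → ∀ t, G' (x, t) = 0)
    (hd : ∀ x t, 0 < t → HasDerivAt (fun s => G (x, s)) (G' (x, t)) t) (t : ℝ) (ht : 0 < t) :
    HasDerivAt (fun s => ∫ x, G (x, s)) (∫ x, G' (x, t)) t := by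
  have hcomp : IsCompact (K ×ˢ Set.Icc (t/2) (2*t)) := hK.prod isCompact_Icc
  have hsub : K ×ˢ Set.Icc (t/2) (2*t) ⊆ {p : Eu N × ℝ | 0 < p.2} := by
    rintro ⟨x, s⟩ ⟨_, hs⟩
    simp only [Set.mem_Icc] at hs
    simp only [Set.mem_ofPred_eq]
    linarith [hs.1]
  obtain ⟨C, hC⟩ := hcomp.exists_bound_of_continuousOn (hG'.mono hsub)
  refine (hasDerivAt_integral_of_dominated_loc_of_deriv_le (s := Set.Ioo (t/2) (2*t))
    (bound := K.indicator fun _ => C) (F' := fun s x => G' (x, s))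
    (Ioo_mem_nhds (by linarith) (by linarith)) ?_ ?_ ?_ ?_ ?_ ?_).2
  · exact Eventually.of_forall fun s => (hG.comp (Continuous.prodMk_left s)).aestronglyMeasurable
  · apply Continuous.integrable_of_hasCompactSupport (hG.comp (Continuous.prodMk_left t))
    exact HasCompactSupport.intro hK (fun x hx => hGz x hx t)
  · have : ContinuousOn (fun x => G' (x, t)) Set.univ := 
      hG'.comp (Continuous.prodMk_left t).continuousOn (fun x _ => ht)
    exact (continuousOn_univ.mp this).aestronglyMeasurable
  · refine Eventually.of_forall fun x s hs => ?_
    by_cases hx : x ∈ K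
    · simp only [Set.indicator_of_mem hx]
      exact hC (x, s) ⟨hx, hs.1.le, hs.2.le⟩
    · simp [hx, hGz' x hx s]
  · rw [integrable_indicator_iff hK.measurableSet]
    exact integrableOn_const hK.measure_lt_top.ne
  · refine Eventually.of_forall fun x s hs => hd x s (by linarith [hs.1])

end part2

section part3

open MeasureTheory Real Filter
open scoped ContDiff
variable {N : ℕ}

def HM (U : Eu N × ℝ → ℝ) (p : Eu N × ℝ) : Matrix (Fin N) (Fin N) ℝ :=
  Matrix.of fun i j => dd (ex j) (dd (ex i) U) p

def gp (φ : Eu N → ℝ) (j : Fin N) (x : Eu N) : Fin N → ℝ := fun l => pd (pd φ j) l x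

def F0 (U : Eu N × ℝ → ℝ) (φ : Eu N → ℝ) (p : Eu N × ℝ) : ℝ := φ p.1 * (HM U p).det

def F1 (U : Eu N × ℝ → ℝ) (φ : Eu N → ℝ) (p : Eu N × ℝ) : ℝ :=
  dd et U p * ∑ j, ((HM U p).updateRow j (gp φ j p.1)).det

def F2 (U : Eu N × ℝ → ℝ) (φ : Eu N → ℝ) (p : Eu N × ℝ) : ℝ :=
  ∑ j, dd et (dd et U) p * ((HM U p).updateRow j (gp φ j p.1)).det
   - ∑ j, ∑ i ∈ Finset.univ.erase j, dd (ex i) (dd et U) p *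
      (((HM U p).updateRow j (gp φ j p.1)).updateRow i (fun l => dd (ex l) (dd et U) p)).det

lemma gp_zero {φ : Eu N → ℝ} {x : Eu N} (hx : x ∉ tsupport φ) (j : Fin N) : gp φ j x = 0 := by
  ext l
  unfold gp
  have h1 : φ =ᶠ[nhds x] 0 := notMem_tsupport_iff_eventuallyEq.mp hx
  have h2 : pd φ j =ᶠ[nhds x] 0 := by
    filter_upwards [h1.eventuallyEq_nhds] with y hy
    unfold pd
    rw [hy.fderiv_eq]
    simp
  have h3 : fderiv ℝ (pd φ j) x = _ := h2.fderiv_eq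
  unfold pd at h3 ⊢
  rw [h3]
  simp

lemma det_upd_zero {n : ℕ} (M : Matrix (Fin n) (Fin n) ℝ) (i : Fin n) {b : Fin n → ℝ} (hb : b = 0) :
    (M.updateRow i b).det = 0 := by
  apply Matrix.det_eq_zero_of_row_eq_zero i
  intro j
  simp [hb]

lemma det_upd2_zero {n : ℕ} (M : Matrix (Fin n) (Fin n) ℝ) (i j : Fin n) (hij : i ≠ j)
    {b c : Fin n → ℝ} (hb : b = 0) :
    ((M.updateRow j b).updateRow i c).det = 0 := by
  apply Matrix.det_eq_zero_of_row_eq_zero j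
  intro l
  rw [Matrix.updateRow_ne hij.symm]
  simp [hb]

lemma continuousOn_updateRow {X : Type*} [TopologicalSpace X] {s : Set X} {n : ℕ}
    {M : X → Matrix (Fin n) (Fin n) ℝ} {i : Fin n} {b : X → Fin n → ℝ}
    (h : ∀ i j, ContinuousOn (fun x => M x i j) s) (hb : ∀ j, ContinuousOn (fun x => b x j) s) :
    ∀ k j, ContinuousOn (fun x => (M x).updateRow i (b x) k j) s := by
  intro k j
  by_cases hk : k = i
  · subst hk; simpa using hb j
  · simpa [Matrix.updateRow_ne hk] using h k j

lemma continuousOn_det_of {X : Type*} [TopologicalSpace X] {s : Set X} {n : ℕ}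
    {M : X → Matrix (Fin n) (Fin n) ℝ}
    (h : ∀ i j, ContinuousOn (fun x => M x i j) s) : ContinuousOn (fun x => (M x).det) s := by
  rw [continuousOn_iff_continuous_domRestrict]
  apply continuous_det_of
  intro i j
  exact continuousOn_iff_continuous_domRestrict.1 (h i j)

section
variable {U : Eu N × ℝ → ℝ} {φ : Eu N → ℝ}

lemma cont_gp (hφ : ContDiff ℝ 2 φ) (j l : Fin N) : Continuous (fun p : Eu N × ℝ => gp φ j p.1 l) := by
  have : Continuous (fun x => gp φ j x l) :=
    (contDiff_pd (m := 0) (contDiff_pd (m := 1) hφ (by norm_num) j) (by norm_num) l).continuous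
  exact this.comp continuous_fst

lemma cont_F0 (hφ : ContDiff ℝ 2 φ) (h2 : ∀ a b, Continuous (dd a (dd b U))) :
    Continuous (F0 U φ) := by
  refine (hφ.continuous.comp continuous_fst).mul (continuous_det_of fun i j => h2 _ _)

lemma cont_F1 (hφ : ContDiff ℝ 2 φ) (h1 : Continuous (dd et U)) (h2 : ∀ a b, Continuous (dd a (dd b U))) :
    Continuous (F1 U φ) := by
  refine h1.mul (continuous_finsetSum _ fun j _ => ?_)
  rw [← continuousOn_univ]
  exact continuousOn_det_of (continuousOn_updateRow (fun i j => (h2 _ _).continuousOn)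
    (fun l => (cont_gp hφ j l).continuousOn))

lemma cont_F2 (hφ : ContDiff ℝ 2 φ) (h2 : ∀ a b, Continuous (dd a (dd b U))) :
    Continuous (F2 U φ) := by
  rw [← continuousOn_univ]
  refine ContinuousOn.sub (continuousOn_finsetSum _ fun j _ => ?_)
    (continuousOn_finsetSum _ fun j _ => continuousOn_finsetSum _ fun i _ => ?_)
  · exact (h2 _ _).continuousOn.mul
      (continuousOn_det_of (continuousOn_updateRow (fun i j => (h2 _ _).continuousOn)
      (fun l => (cont_gp hφ j l).continuousOn)))
  · exact (h2 _ _).continuousOn.mul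
      (continuousOn_det_of (continuousOn_updateRow (continuousOn_updateRow
        (fun i j => (h2 _ _).continuousOn)
      (fun l => (cont_gp hφ j l).continuousOn)) (fun l => (h2 _ _).continuousOn)))

lemma F0_zero {x : Eu N} (hx : x ∉ tsupport φ) (t : ℝ) : F0 U φ (x, t) = 0 := by
  simp [F0, image_eq_zero_of_notMem_tsupport hx]

lemma F1_zero {x : Eu N} (hx : x ∉ tsupport φ) (t : ℝ) : F1 U φ (x, t) = 0 := by
  simp [F1, gp_zero hx, det_upd_zero]

lemma F2_zero {x : Eu N} (hx : x ∉ tsupport φ) (t : ℝ) : F2 U φ (x, t) = 0 := by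
  unfold F2
  rw [Finset.sum_eq_zero, Finset.sum_eq_zero, sub_zero]
  · intro j _
    apply Finset.sum_eq_zero
    intro i hi
    rw [det_upd2_zero _ _ _ (Finset.ne_of_mem_erase hi) (gp_zero hx j), mul_zero]
  · intro j _
    rw [det_upd_zero _ _ (gp_zero hx j), mul_zero]

lemma deriv_F0 (hS : Sm U) (hφ : ContDiff ℝ 2 φ) (hφs : HasCompactSupport φ)
    (h2 : ∀ a b, Continuous (dd a (dd b U))) (t : ℝ) (ht : 0 < t) :
    HasDerivAt (fun s => ∫ x, F0 U φ (x, s)) (∫ x, F1 U φ (x, t)) t := by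
  set G' : Eu N × ℝ → ℝ := fun p => φ p.1 * ∑ i, ((HM U p).updateRow i
    (fun l => dd (ex l) (dd (ex i) (dd et U)) p)).det with hG'
  have h := hasDerivAt_int (F0 U φ) G' (tsupport φ) hφs (cont_F0 hφ h2) ?_
    (fun x hx t => F0_zero hx t) ?_ ?_ t ht
  · convert h using 1
    have hib := first_ibp (fun x => U (x, t)) (fun x => dd et U (x, t)) φ (hS.slice ht)
      ((hS.dd et).slice ht) hφ hφs
    have hM : ∀ x, (Matrix.of fun i j => pd ((fun k => pd (fun x => U (x, t)) k) i) j x) = HM U (x, t) := by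
      intro x
      ext i j
      simp only [Matrix.of_apply, HM]
      rw [hS.pd_slice ht, (hS.dd _).pd_slice ht]
    simp only [JD_update, hM] at hib
    symm
    convert hib using 1
    · congr 1
      ext x
      rw [hG']
      simp only
      congr 1
      apply Finset.sum_congr rfl
      intro i _
      congr 2
      ext l
      rw [(hS.dd _).pd_slice ht, ((hS.dd _).dd _).pd_slice ht]
    · rfl
  · refine (hφ.continuous.comp continuous_fst).continuousOn.mul
      (continuousOn_finsetSum _ fun j _ => ?_)
    exact continuousOn_det_of (continuousOn_updateRow (fun i j => (h2 _ _).continuousOn)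
      (fun l => (((hS.dd _).dd _).dd _).continuousOn))
  · intro x hx t
    simp [hG', image_eq_zero_of_notMem_tsupport hx]
  · intro x t ht
    simp only [hG', F0]
    apply HasDerivAt.const_mul
    apply hasDerivAt_det
    intro i j
    have := ((hS.dd (ex i)).dd (ex j)).dt_slice x ht
    simp only [HM, Matrix.of_apply]
    convert this using 1
    rw [(hS.dd (ex i)).comm et (ex j) ht]
    apply dd_congr _ _ ht
    intro p hp
    exact hS.comm _ _ hp

lemma deriv_F1 (hS : Sm U) (hφ : ContDiff ℝ 2 φ) (hφs : HasCompactSupport φ)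
    (h1 : Continuous (dd et U))
    (h2 : ∀ a b, Continuous (dd a (dd b U))) (t : ℝ) (ht : 0 < t) :
    HasDerivAt (fun s => ∫ x, F1 U φ (x, s)) (∫ x, F2 U φ (x, t)) t := by
  set R : Eu N × ℝ → ℝ := fun p => ∑ j, ∑ i ∈ Finset.univ.erase j, dd et U p *
      (((HM U p).updateRow j (gp φ j p.1)).updateRow i
        (fun l => dd (ex l) (dd (ex i) (dd et U)) p)).det with hR
  set Q : Eu N × ℝ → ℝ := fun p => ∑ j, dd et (dd et U) p * ((HM U p).updateRow j (gp φ j p.1)).det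
    with hQ
  set S : Eu N × ℝ → ℝ := fun p => ∑ j, ∑ i ∈ Finset.univ.erase j, dd (ex i) (dd et U) p *
      (((HM U p).updateRow j (gp φ j p.1)).updateRow i (fun l => dd (ex l) (dd et U) p)).det with hSS
  have cQ : Continuous Q := by
    rw [← continuousOn_univ]
    refine (continuousOn_finsetSum _ fun j _ => ?_)
    exact (h2 _ _).continuousOn.mul
      (continuousOn_det_of (continuousOn_updateRow (fun i j => (h2 _ _).continuousOn)
      (fun l => (cont_gp hφ j l).continuousOn)))
  have zQ : ∀ x, x ∉ tsupport φ → ∀ t, Q (x, t) = 0 := by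
    intro x hx t
    simp only [hQ]
    apply Finset.sum_eq_zero
    intro j _
    rw [det_upd_zero _ _ (gp_zero hx j), mul_zero]
  have cR1 : ∀ i j, ContinuousOn (fun p => dd et U p *
      (((HM U p).updateRow j (gp φ j p.1)).updateRow i
        (fun l => dd (ex l) (dd (ex i) (dd et U)) p)).det) {p | 0 < p.2} := by
    intro i j
    exact h1.continuousOn.mul
      (continuousOn_det_of (continuousOn_updateRow (continuousOn_updateRow
        (fun i j => (h2 _ _).continuousOn)
      (fun l => (cont_gp hφ j l).continuousOn)) (fun l => (((hS.dd _).dd _).dd _).continuousOn)))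
  have cS1 : ∀ i j, ContinuousOn (fun p => dd (ex i) (dd et U) p *
      (((HM U p).updateRow j (gp φ j p.1)).updateRow i
        (fun l => dd (ex l) (dd et U) p)).det) {p | 0 < p.2} := by
    intro i j
    exact (h2 _ _).continuousOn.mul
      (continuousOn_det_of (continuousOn_updateRow (continuousOn_updateRow
        (fun i j => (h2 _ _).continuousOn)
      (fun l => (cont_gp hφ j l).continuousOn)) (fun l => (h2 _ _).continuousOn)))
  have cR : ContinuousOn R {p | 0 < p.2} :=
    continuousOn_finsetSum _ fun j _ => continuousOn_finsetSum _ fun i _ => cR1 i j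
  have z1 : ∀ x, x ∉ tsupport φ → ∀ t a c, ∀ i j, i ≠ j → a * (((HM U (x, t)).updateRow j 
      (gp φ j x)).updateRow i c).det = 0 := by
    intro x hx t a c i j hij
    rw [det_upd2_zero _ _ _ hij (gp_zero hx j), mul_zero]
  have zR : ∀ x, x ∉ tsupport φ → ∀ t, R (x, t) = 0 := by
    intro x hx t
    exact Finset.sum_eq_zero fun j _ => Finset.sum_eq_zero fun i hi =>
      z1 x hx t _ _ i j (Finset.ne_of_mem_erase hi)
  have int : ∀ (G : Eu N × ℝ → ℝ), ContinuousOn G {p | 0 < p.2} → 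
      (∀ x, x ∉ tsupport φ → G (x, t) = 0) → Integrable (fun x => G (x, t)) := by
    intro G hG hz
    have : ContinuousOn (fun x => G (x, t)) Set.univ := 
      hG.comp (Continuous.prodMk_left t).continuousOn (fun x _ => ht)
    exact (continuousOn_univ.mp this).integrable_of_hasCompactSupport (HasCompactSupport.intro hφs hz)
  have h := hasDerivAt_int (F1 U φ) (fun p => Q p + R p) (tsupport φ) hφs (cont_F1 hφ h1 h2)
    (cQ.continuousOn.add cR)
    (fun x hx t => F1_zero hx t) (fun x hx t => by simp only [zQ x hx t, zR x hx t, add_zero]) ?_ t ht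
  · convert h using 1
    have e1 : ∀ x, F2 U φ (x, t) = Q (x, t) - S (x, t) := fun x => rfl
    have hM : ∀ x, (Matrix.of fun i j => pd ((fun k => pd (fun x => U (x, t)) k) i) j x) = HM U (x, t) := by
      intro x
      ext i j
      simp only [Matrix.of_apply, HM]
      rw [hS.pd_slice ht, (hS.dd _).pd_slice ht]
    have hJ2 : ∀ i j : Fin N, i ≠ j → ∀ (g : Eu N → ℝ) x,
        JD (Function.update (Function.update (fun k => pd (fun x => U (x, t)) k) j (pd φ j)) i g) x
         = (((HM U (x, t)).updateRow j (gp φ j x)).updateRow i (fun l => pd g l x)).det := by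
      intro i j hij g x
      rw [JD_update, ← hM]
      congr 2
      ext a b
      by_cases ha : a = j
      · subst ha; simp [gp]
      · simp [ha, Matrix.updateRow_ne]
    have hib : ∀ i j : Fin N, i ≠ j → ∫ x, dd et U (x, t) *
      (((HM U (x, t)).updateRow j (gp φ j x)).updateRow i
        (fun l => dd (ex l) (dd (ex i) (dd et U)) (x, t))).det = - ∫ x, dd (ex i) (dd et U) (x, t) *
      (((HM U (x, t)).updateRow j (gp φ j x)).updateRow i
        (fun l => dd (ex l) (dd et U) (x, t))).det := by
      intro i j hij
      have := second_ibp (fun x => U (x, t)) (fun x => dd et U (x, t)) φ (hS.slice ht)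
        ((hS.dd et).slice ht) hφ hφs i j hij
      simp only [hJ2 i j hij, (hS.dd et).pd_slice ht, ((hS.dd et).dd _).pd_slice ht] at this
      exact this
    have hRS : ∫ x, R (x, t) = - ∫ x, S (x, t) := by
      simp only [hR, hSS]
      rw [integral_finsetSum, integral_finsetSum, ← Finset.sum_neg_distrib]
      · apply Finset.sum_congr rfl
        intro j _
        rw [integral_finsetSum, integral_finsetSum, ← Finset.sum_neg_distrib]
        · apply Finset.sum_congr rfl
          intro i hi
          exact hib i j (Finset.ne_of_mem_erase hi)
        · intro i hi
          exact int _ (cS1 i j) (fun x hx => z1 x hx t _ _ i j (Finset.ne_of_mem_erase hi))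
        · intro i hi
          exact int _ (cR1 i j) (fun x hx => z1 x hx t _ _ i j (Finset.ne_of_mem_erase hi))
      · intro j _
        apply integrable_finsetSum
        intro i hi
        exact int _ (cS1 i j) (fun x hx => z1 x hx t _ _ i j (Finset.ne_of_mem_erase hi))
      · intro j _
        apply integrable_finsetSum
        intro i hi
        exact int _ (cR1 i j) (fun x hx => z1 x hx t _ _ i j (Finset.ne_of_mem_erase hi))
    have iQ := int Q cQ.continuousOn (fun x hx => zQ x hx t)
    simp only [e1]
    rw [integral_add iQ (int R cR (fun x hx => zR x hx t)), hRS, integral_sub iQ]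
    · ring
    · apply integrable_finsetSum
      intro j _
      apply integrable_finsetSum
      intro i hi
      exact int _ (cS1 i j) (fun x hx => z1 x hx t _ _ i j (Finset.ne_of_mem_erase hi))
  · intro x t ht
    simp only [F1]
    have hd1 := (hS.dd et).dt_slice x ht
    have hd2 : ∀ j, HasDerivAt (fun s => ((HM U (x, s)).updateRow j (gp φ j x)).det)
      (∑ i ∈ Finset.univ.erase j, (((HM U (x, t)).updateRow j (gp φ j x)).updateRow i
        (fun l => dd (ex l) (dd (ex i) (dd et U)) (x, t))).det) t := by
      intro j
      have := hasDerivAt_det (fun s => (HM U (x, s)).updateRow j (gp φ j x))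
        (Matrix.updateRow (Matrix.of fun i l => dd (ex l) (dd (ex i) (dd et U)) (x, t)) j 0) t ?_
      · refine this.congr_deriv ?_
        rw [← Finset.add_sum_erase _ _ (Finset.mem_univ j), det_upd_zero, zero_add]
        · apply Finset.sum_congr rfl
          intro i hi
          congr 2
          ext l
          rw [Matrix.updateRow_ne (Finset.ne_of_mem_erase hi)]
          rfl
        · simp
      · intro i l
        by_cases hi : i = j
        · subst hi; simpa using hasDerivAt_const t _
        · simp only [Matrix.updateRow_ne hi]
          have := ((hS.dd (ex i)).dd (ex l)).dt_slice x ht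
          simp only [HM, Matrix.of_apply]
          convert this using 1
          rw [(hS.dd (ex i)).comm et (ex l) ht]
          apply dd_congr _ _ ht
          intro p hp
          exact hS.comm _ _ hp
    have := hd1.mul (HasDerivAt.fun_sum (u := Finset.univ) fun j _ => hd2 j)
    refine this.congr_deriv ?_
    simp only [hQ, hR, Finset.mul_sum]

lemma cont_int {G : Eu N × ℝ → ℝ} (hG : Continuous G) {K : Set (Eu N)} (hK : IsCompact K)
    (hz : ∀ x, x ∉ K → ∀ t, G (x, t) = 0) : Continuous (fun t => ∫ x, G (x, t)) := by
  have h := continuous_parametric_integral_of_continuous (μ := (volume : Measure (Eu N)))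
    (f := fun (t : ℝ) (x : Eu N) => G (x, t)) (s := K) (by
      exact hG.comp (continuous_snd.prodMk continuous_fst)) hK
  convert h using 2 with t
  symm
  apply setIntegral_eq_integral_of_forall_compl_eq_zero
  intro x hx
  exact hz x hx t

theorem ident (hS : Sm U) (hφ : ContDiff ℝ 2 φ) (hφs : HasCompactSupport φ)
    (h1 : Continuous (dd et U)) (h2 : ∀ a b, Continuous (dd a (dd b U))) :
    (∫ x, F0 U φ (x, 0)) = (∫ x, F0 U φ (x, 1)) - (∫ x, F1 U φ (x, 1))
      + ∫ t in (0:ℝ)..1, t * ∫ x, F2 U φ (x, t) := by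
  have c0 := cont_int (cont_F0 hφ h2) hφs (fun x hx t => F0_zero hx t)
  have c1 := cont_int (cont_F1 hφ h1 h2) hφs (fun x hx t => F1_zero hx t)
  have c2 := cont_int (cont_F2 hφ h2) hφs (fun x hx t => F2_zero hx t)
  have := intervalIntegral.integral_eq_sub_of_hasDerivAt_of_le (a := 0) (b := 1)
    (f := fun t => t * (∫ x, F1 U φ (x, t)) - ∫ x, F0 U φ (x, t))
    (f' := fun t => t * ∫ x, F2 U φ (x, t)) zero_le_one
    ((continuous_id.mul c1).sub c0).continuousOn ?_
    ((continuous_id.mul c2).intervalIntegrable _ _)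
  · rw [this]; ring
  · intro t ht
    have := ((hasDerivAt_id t).mul (deriv_F1 hS hφ hφs h1 h2 t ht.1)).sub (deriv_F0 hS hφ hφs h2 t ht.1)
    refine this.congr_deriv ?_
    simp
end

end part3

section part4

open MeasureTheory Real Filter
open scoped ContDiff Convolution
variable {N : ℕ}

def MW (w g : Eu N → ℝ) (p : Eu N × ℝ) : ℝ := ∫ z, w z * g (p.1 + p.2 • z)

structure WW (w : Eu N → ℝ) : Prop where
  smooth : ContDiff ℝ ∞ w
  zero : ∀ z, 1 < ‖z‖ → w z = 0

lemma WW.hcs {w : Eu N → ℝ} (hw : WW w) : HasCompactSupport w :=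
  HasCompactSupport.intro (isCompact_closedBall 0 1) (fun z hz => hw.zero z (by simpa using hz))

lemma WW.cont {w : Eu N → ℝ} (hw : WW w) : Continuous w := hw.smooth.continuous

lemma WW.pd {w : Eu N → ℝ} (hw : WW w) (i : Fin N) : WW (pd w i) where
  smooth := contDiff_pd hw.smooth (by simp) i
  zero := by
    intro z hz
    have : w =ᶠ[nhds z] 0 := by
      have ho : IsOpen {z : Eu N | 1 < ‖z‖} := isOpen_lt continuous_const continuous_norm
      filter_upwards [ho.mem_nhds hz] with y hy using hw.zero y hy
    unfold _root_.pd
    rw [this.fderiv_eq]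
    simp

def lam (v : Eu N × ℝ) (k : Fin N) (z : Eu N) : ℝ := v.1 k + v.2 * z k

lemma contDiff_coord (k : Fin N) : ContDiff ℝ ∞ (fun z : Eu N => z k) :=
  (EuclideanSpace.proj (𝕜 := ℝ) k).contDiff

lemma WW.lam {w : Eu N → ℝ} (hw : WW w) (v : Eu N × ℝ) (k : Fin N) : WW (fun z => w z * lam v k z) where
  smooth := hw.smooth.mul (contDiff_const.add (contDiff_const.mul (contDiff_coord k)))
  zero := by
    intro z hz
    simp [hw.zero z hz]

lemma MW_cont {w g : Eu N → ℝ} (hw : WW w) (hg : Continuous g) : Continuous (MW w g) := by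
  have h := continuous_parametric_integral_of_continuous (μ := (volume : Measure (Eu N)))
    (f := fun (p : Eu N × ℝ) (z : Eu N) => w z * g (p.1 + p.2 • z)) (s := Metric.closedBall 0 1) (by
      have := hw.cont
      simp only [Function.uncurry_def]
      fun_prop) (isCompact_closedBall 0 1)
  convert h using 2 with p
  symm
  apply setIntegral_eq_integral_of_forall_compl_eq_zero
  intro x hx
  rw [hw.zero x (by simpa using hx), zero_mul]

lemma fderiv_eq_sum (g : Eu N → ℝ) (y v : Eu N) : fderiv ℝ g y v = ∑ k, v k * pd g k y := by
  have : v = ∑ k, v k • (ebasis k : Eu N) := by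
    ext j
    simp [ebasis, Finset.sum_apply, Pi.single_apply]
  conv_lhs => rw [this]
  rw [map_sum]
  simp [pd]

lemma MW_dd_aux {w g : Eu N → ℝ} (hw : WW w) (hg : ContDiff ℝ 1 g) (hgs : HasCompactSupport g)
    (v p : Eu N × ℝ) : DifferentiableAt ℝ (MW w g) p ∧
      dd v (MW w g) p = ∑ k, MW (fun z => w z * lam v k z) (pd g k) p := by
  have hgd : Continuous (fderiv ℝ g) := hg.continuous_fderiv (by norm_num)
  obtain ⟨C, hC⟩ := hgd.bounded_above_of_compact_support (hgs.fderiv (𝕜 := ℝ))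
  set Lz : Eu N → (Eu N × ℝ →L[ℝ] Eu N) := fun z =>
    ContinuousLinearMap.fst ℝ (Eu N) ℝ + (ContinuousLinearMap.snd ℝ (Eu N) ℝ).smulRight z with hLz
  have hLzv : ∀ z q, Lz z q = q.1 + q.2 • z := by intro z q; simp [hLz]
  have hLc : Continuous Lz := by
    rw [hLz]
    refine continuous_const.add ?_
    exact (ContinuousLinearMap.smulRightL ℝ (Eu N × ℝ) (Eu N) (ContinuousLinearMap.snd ℝ (Eu N) ℝ)).continuous
  have hFc : Continuous fun z => w z • (fderiv ℝ g (p.1 + p.2 • z)).comp (Lz z) := by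
    have := hw.cont
    refine this.smul ?_
    refine Continuous.clm_comp ?_ hLc
    exact hgd.comp (by fun_prop)
  have hFs : HasCompactSupport fun z => w z • (fderiv ℝ g (p.1 + p.2 • z)).comp (Lz z) :=
    hw.hcs.smul_right
  have key : HasFDerivAt (MW w g) (∫ z, w z • (fderiv ℝ g (p.1 + p.2 • z)).comp (Lz z)) p := by
    refine hasFDerivAt_integral_of_dominated_of_fderiv_le (s := Set.univ)
      (F' := fun q z => w z • (fderiv ℝ g (q.1 + q.2 • z)).comp (Lz z))
      (bound := fun z => ‖w z‖ * (C * ‖Lz z‖)) univ_mem ?_ ?_ ?_ ?_ ?_ ?_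
    · refine Eventually.of_forall fun q => Continuous.aestronglyMeasurable ?_
      have := hw.cont
      have := hg.continuous
      fun_prop
    · apply Continuous.integrable_of_hasCompactSupport
      · have := hw.cont
        have := hg.continuous
        fun_prop
      · exact hw.hcs.mul_right
    · exact hFc.aestronglyMeasurable
    · refine Eventually.of_forall fun z q _ => ?_
      rw [norm_smul]
      gcongr
      refine (ContinuousLinearMap.opNorm_comp_le _ _).trans ?_
      gcongr
      exact hC _
    · apply Continuous.integrable_of_hasCompactSupport
      · have := hw.cont
        fun_prop
      · exact hw.hcs.norm.mul_right
    · refine Eventually.of_forall fun z q _ => ?_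
      have h1 : HasFDerivAt (fun q : Eu N × ℝ => q.1 + q.2 • z) (Lz z) q := by
        have := (Lz z).hasFDerivAt (x := q)
        exact this.congr_of_eventuallyEq (Eventually.of_forall fun q => (hLzv z q).symm)
      have h2 : HasFDerivAt g (fderiv ℝ g (q.1 + q.2 • z)) (q.1 + q.2 • z) :=
        ((hg.differentiable (by norm_num)) _).hasFDerivAt
      exact (h2.comp q h1).const_mul (w z)
  refine ⟨key.differentiableAt, ?_⟩
  unfold dd
  rw [key.fderiv, ContinuousLinearMap.integral_apply (hFc.integrable_of_hasCompactSupport hFs)]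
  unfold MW
  rw [← integral_finsetSum]
  · congr 1
    ext z
    simp only [_root_.smul_apply, ContinuousLinearMap.comp_apply, hLzv, smul_eq_mul]
    rw [fderiv_eq_sum, Finset.mul_sum]
    apply Finset.sum_congr rfl
    intro k _
    simp [lam]
    ring
  · intro k _
    apply Continuous.integrable_of_hasCompactSupport
    · have := (hw.lam v k).cont
      have := (contDiff_pd (m := 0) hg (by norm_num) k).continuous
      fun_prop
    · exact (hw.lam v k).hcs.mul_right

lemma MW_dd {w g : Eu N → ℝ} (hw : WW w) (hg : ContDiff ℝ 1 g) (hgs : HasCompactSupport g)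
    (v : Eu N × ℝ) : dd v (MW w g) = fun p => ∑ k, MW (fun z => w z * lam v k z) (pd g k) p :=
  funext fun p => (MW_dd_aux hw hg hgs v p).2

lemma MW_smooth {w g : Eu N → ℝ} (hw : WW w) (hg : Continuous g) : Sm (MW w g) := by
  rintro ⟨x₀, t₀⟩ ht₀
  simp only at ht₀
  have hconv : ∀ x t, 0 < t → MW w g (x, t) = (t ^ N)⁻¹ *
      (g ⋆[ContinuousLinearMap.mul ℝ ℝ, volume] (fun y => w (-(t⁻¹ • y)))) x := by
    intro x t ht
    have h1 := Measure.integral_comp_smul (volume : Measure (Eu N))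
      (fun z => w (t⁻¹ • z) * g (x + z)) t
    simp only [inv_smul_smul₀ ht.ne'] at h1
    unfold MW
    rw [h1]
    simp only [finrank_euclideanSpace, Fintype.card_fin, smul_eq_mul]
    rw [abs_of_pos (by positivity)]
    congr 1
    rw [convolution_def]
    have h4 := integral_add_left_eq_self (μ := (volume : Measure (Eu N)))
      (fun y => g y * w (-(t⁻¹ • (x - y)))) x
    simp only [ContinuousLinearMap.mul_apply']
    rw [← h4]
    congr 1
    ext z
    rw [mul_comm]
    simp
  have hc := contDiffOn_convolution_right_with_param (𝕜 := ℝ) (μ := (volume : Measure (Eu N))) (n := ⊤)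
    (f := g) (ContinuousLinearMap.mul ℝ ℝ) (g := fun (t : ℝ) (y : Eu N) => w (-(t⁻¹ • y)))
    (s := Set.Ioo 0 (t₀ + 1)) (k := Metric.closedBall 0 (t₀ + 1)) isOpen_Ioo
    (isCompact_closedBall _ _) ?_ hg.locallyIntegrable ?_
  · have h2 : ContDiffAt ℝ ∞ (fun p : Eu N × ℝ => (p.2 ^ N)⁻¹ *
      (g ⋆[ContinuousLinearMap.mul ℝ ℝ, volume] (fun y => w (-(p.2⁻¹ • y)))) p.1) (x₀, t₀) := by
      refine ContDiffAt.mul ?_ ?_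
      · exact (contDiffAt_snd.pow N).inv (pow_ne_zero _ ht₀.ne')
      · have h3 := hc.contDiffAt (x := (t₀, x₀)) (by
          apply IsOpen.mem_nhds (isOpen_Ioo.prod isOpen_univ)
          exact ⟨⟨ht₀, by linarith⟩, trivial⟩)
        exact ContDiffAt.comp (x₀, t₀) (f := fun p : Eu N × ℝ => (p.2, p.1)) h3
          (contDiffAt_snd.prodMk contDiffAt_fst)
    refine h2.congr_of_eventuallyEq ?_
    have ho : IsOpen {p : Eu N × ℝ | 0 < p.2} := isOpen_lt continuous_const continuous_snd
    filter_upwards [ho.mem_nhds (show (x₀, t₀) ∈ {p : Eu N × ℝ | 0 < p.2} from ht₀)] with q hq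
    exact hconv q.1 q.2 hq
  · intro t y ht hy
    apply hw.zero
    simp only [Metric.mem_closedBall, dist_zero_right, not_le] at hy
    rw [norm_neg, norm_smul, norm_inv, Real.norm_of_nonneg ht.1.le, inv_mul_eq_div, one_lt_div ht.1]
    linarith [ht.2]
  · apply hw.smooth.comp_contDiffOn
    apply ContDiffOn.neg
    apply ContDiffOn.fun_smul
    · apply ContDiffOn.inv contDiffOn_fst
      rintro ⟨t, y⟩ ⟨ht, _⟩
      exact ht.1.ne'
    · exact contDiffOn_snd

lemma MW_ibp {w g : Eu N → ℝ} (hw : WW w) (hg : ContDiff ℝ 1 g) (l : Fin N) (x : Eu N) (t c : ℝ) :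
    t * MW w (pd g l) (x, t) = - ∫ z, pd w l z * (g (x + t • z) - c) := by
  have hd : ∀ z, fderiv ℝ (fun z => g (x + t • z) - c) z (ebasis l) = t * pd g l (x + t • z) := by
    intro z
    have h1 : HasFDerivAt (fun z : Eu N => x + t • z) (t • ContinuousLinearMap.id ℝ (Eu N)) z :=
      ((hasFDerivAt_id z).const_smul t).const_add x
    have h2 := (((hg.differentiable (by norm_num)) (x + t • z)).hasFDerivAt.comp z h1).sub_const c
    have h3 : fderiv ℝ (fun z => g (x + t • z) - c) z = _ := h2.fderiv
    rw [h3]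
    simp [pd]
  have hpg := (contDiff_pd (m := 0) hg (by norm_num) l).continuous
  have hpw := (hw.pd l).cont
  have hgc := hg.continuous
  have hwc := hw.cont
  have := integral_mul_fderiv_eq_neg_fderiv_mul_of_integrable (μ := (volume : Measure (Eu N)))
    (f := w) (g := fun z => g (x + t • z) - c) (v := ebasis l) ?_ ?_ ?_ ?_ ?_
  · unfold pd at this ⊢
    rw [← this]
    unfold MW
    rw [← integral_const_mul]
    congr 1
    ext z
    rw [hd z]
    simp only [pd]
    ring
  · apply Continuous.integrable_of_hasCompactSupport
    · have : Continuous fun z => pd w l z * (g (x + t • z) - c) := by fun_prop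
      exact this
    · exact (hw.pd l).hcs.mul_right
  · simp only [hd]
    apply Continuous.integrable_of_hasCompactSupport
    · fun_prop
    · exact hw.hcs.mul_right
  · apply Continuous.integrable_of_hasCompactSupport
    · fun_prop
    · exact hw.hcs.mul_right
  · intro z _
    exact hw.smooth.differentiable (by simp) z
  · intro z _
    have := hg.differentiable (by norm_num)
    fun_prop

/-- a normalised bump -/
lemma exists_WW : ∃ ρ : Eu N → ℝ, WW ρ ∧ ∫ z, ρ z = 1 := by
  let b : ContDiffBump (0 : Eu N) := ⟨1/2, 1, by norm_num, by norm_num⟩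
  refine ⟨b.normed volume, ⟨b.contDiff_normed, ?_⟩, b.integral_normed⟩
  intro z hz
  have : z ∉ Function.support (b.normed volume) := by
    rw [b.support_normed_eq]
    simp only [Metric.mem_ball, dist_zero_right, not_lt]
    exact hz.le
  simpa using this

end part4

section part5

open MeasureTheory Real Filter
open scoped ContDiff ENNReal
variable {N : ℕ}

lemma jensen (hN : 3 ≤ N) {W : Eu N → ℝ} (hW : WW W) : ∃ C : ℝ≥0∞, C ≠ ⊤ ∧ ∀ h : Eu N → ℝ, Continuous h →
    ‖∫ z, W z * h z‖ₑ ^ N ≤ C * ∫⁻ z in Metric.closedBall 0 1, ‖h z‖ₑ ^ N := by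
  obtain ⟨C0, hC0⟩ := hW.cont.bounded_above_of_compact_support hW.hcs
  have hpq : (N : ℝ).HolderConjugate (Real.conjExponent N) :=
    Real.HolderConjugate.conjExponent (by exact_mod_cast (by omega : 1 < N))
  set B : Set (Eu N) := Metric.closedBall 0 1
  have hB : volume B ≠ ⊤ := (isCompact_closedBall _ _).measure_lt_top.ne
  have hNr : (0:ℝ) < N := by exact_mod_cast (by omega : 0 < N)
  refine ⟨ENNReal.ofReal C0 ^ N * ((volume B) ^ (1 / Real.conjExponent N)) ^ N, ?_, ?_⟩
  · apply ENNReal.mul_ne_top (by simp)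
    apply ENNReal.pow_ne_top
    exact ENNReal.rpow_ne_top_of_nonneg (by have := hpq.symm.pos; positivity) hB
  · intro h hh
    have h1 : ‖∫ z, W z * h z‖ₑ ≤ ENNReal.ofReal C0 * ∫⁻ z in B, ‖h z‖ₑ := by
      rw [← setIntegral_eq_integral_of_forall_compl_eq_zero (s := B)]
      · refine (enorm_integral_le_lintegral_enorm _).trans ?_
        rw [← lintegral_const_mul' _ _ (by simp)]
        apply lintegral_mono
        intro z
        simp only [enorm_mul]
        gcongr
        rw [← ofReal_norm]
        exact ENNReal.ofReal_le_ofReal (hC0 z)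
      · intro z hz
        rw [hW.zero z (by simpa [B] using hz), zero_mul]
    have h2 : ∫⁻ z in B, ‖h z‖ₑ ≤ (∫⁻ z in B, ‖h z‖ₑ ^ N) ^ (1 / (N:ℝ)) *
        (volume B) ^ (1 / Real.conjExponent N) := by
      have := ENNReal.lintegral_mul_le_Lp_mul_Lq (volume.restrict B) hpq (f := fun z => ‖h z‖ₑ)
        (g := fun _ => 1) (by fun_prop) (by fun_prop)
      simpa using this
    calc _ ≤ (ENNReal.ofReal C0 * ((∫⁻ z in B, ‖h z‖ₑ ^ N) ^ (1 / (N:ℝ)) *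
        (volume B) ^ (1 / Real.conjExponent N))) ^ N := by
          gcongr
          exact h1.trans (by gcongr)
      _ = _ := by
          rw [mul_pow, mul_pow, ← ENNReal.rpow_natCast (_ ^ (1/(N:ℝ))), ← ENNReal.rpow_mul]
          rw [one_div_mul_cancel hNr.ne', ENNReal.rpow_one]
          ring

lemma est_one (hN : 3 ≤ N) {W : Eu N → ℝ} (hW : WW W) : ∃ C : ℝ≥0∞, C ≠ ⊤ ∧ ∀ g : Eu N → ℝ,
    Continuous g → ∫⁻ x, ‖MW W g (x, 1)‖ₑ ^ N ≤ C * ∫⁻ x, ‖g x‖ₑ ^ N := by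
  obtain ⟨C, hC, h⟩ := jensen hN hW
  refine ⟨C * volume (Metric.closedBall (0 : Eu N) 1), ENNReal.mul_ne_top hC
    (isCompact_closedBall _ _).measure_lt_top.ne, ?_⟩
  intro g hg
  calc _ ≤ ∫⁻ x, C * ∫⁻ z in Metric.closedBall 0 1, ‖g (x + z)‖ₑ ^ N := by
        apply lintegral_mono
        intro x
        have := h (fun z => g (x + z)) (by fun_prop)
        simpa [MW] using this
    _ = _ := by
        rw [lintegral_const_mul' _ _ hC, lintegral_lintegral_swap (by fun_prop)]
        have : ∀ z : Eu N, ∫⁻ x, ‖g (x + z)‖ₑ ^ N = ∫⁻ x, ‖g x‖ₑ ^ N := fun z =>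
          lintegral_add_right_eq_self (fun x => ‖g x‖ₑ ^ N) z
        simp only [this]
        rw [lintegral_const]
        simp
        ring

lemma scale_ball (x : Eu N) {t : ℝ} (ht : 0 < t) (G : Eu N → ℝ≥0∞) (hG : Measurable G) :
    ∫⁻ z in Metric.closedBall (0 : Eu N) 1, G (x + t • z) =
      (ENNReal.ofReal t ^ N)⁻¹ * ∫⁻ y, {y | ‖x - y‖ ≤ t}.indicator G y := by
  have hm : MeasurableSet {y : Eu N | ‖x - y‖ ≤ t} := by measurability
  rw [← lintegral_indicator Metric.isClosed_closedBall.measurableSet]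
  have h1 : ∀ z, (Metric.closedBall (0 : Eu N) 1).indicator (fun z => G (x + t • z)) z
     = {y | ‖x - y‖ ≤ t}.indicator G (x + t • z) := by
    intro z
    by_cases hz : ‖z‖ ≤ 1
    · rw [Set.indicator_of_mem (by simpa using hz), Set.indicator_of_mem]
      simp only [Set.mem_ofPred_eq, sub_add_cancel_left, norm_neg, norm_smul, Real.norm_of_nonneg ht.le]
      nlinarith
    · rw [Set.indicator_of_notMem (by simpa using hz), Set.indicator_of_notMem]
      simp only [Set.mem_ofPred_eq, sub_add_cancel_left, norm_neg, norm_smul, Real.norm_of_nonneg ht.le]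
      nlinarith
  simp only [h1]
  have h2 : ∫⁻ z, {y | ‖x - y‖ ≤ t}.indicator G (x + t • z) = 
     ∫⁻ z', {y | ‖x - y‖ ≤ t}.indicator G (x + z') ∂(Measure.map (fun z : Eu N => t • z) volume) := by
    have hmm : Measurable (fun z' => {y : Eu N | ‖x - y‖ ≤ t}.indicator G (x + z')) :=
      (hG.indicator hm).comp (measurable_const_add x)
    rw [lintegral_map hmm (by fun_prop)]
  rw [h2, Measure.map_addHaar_smul _ ht.ne', lintegral_smul_measure,
    lintegral_add_left_eq_self (μ := (volume : Measure (Eu N)))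
     ({y : Eu N | ‖x - y‖ ≤ t}.indicator G) x]
  rw [finrank_euclideanSpace, Fintype.card_fin, abs_of_pos (by positivity),
    ENNReal.ofReal_inv_of_pos (by positivity), ENNReal.ofReal_pow ht.le, smul_eq_mul]

lemma time_int (hN : 3 ≤ N) {r : ℝ} (hr : 0 < r) :
    ∫⁻ t in Set.Ioc (0:ℝ) 1, {t : ℝ | r ≤ t}.indicator
      (fun t => ENNReal.ofReal t * (ENNReal.ofReal t ^ (2 * N))⁻¹) t ≤
      (ENNReal.ofReal r ^ (2 * N - 2))⁻¹ := by
  have hN' : (3:ℝ) ≤ N := by exact_mod_cast hN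
  have hm : MeasurableSet {t : ℝ | r ≤ t} := measurableSet_Ici
  have ha : (1 - 2 * N : ℝ) < -1 := by linarith
  set J : ℝ → ℝ≥0∞ := fun t => ENNReal.ofReal t * (ENNReal.ofReal t ^ (2 * N))⁻¹ with hJ
  calc _ ≤ ∫⁻ t, {t : ℝ | r ≤ t}.indicator J t := setLIntegral_le_lintegral _ _
    _ = ∫⁻ t in Set.Ioi r, ENNReal.ofReal t * (ENNReal.ofReal t ^ (2 * N))⁻¹ := by
        rw [lintegral_indicator hm]
        exact setLIntegral_congr Ioi_ae_eq_Ici.symm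
    _ = ∫⁻ t in Set.Ioi r, ENNReal.ofReal (t ^ (1 - 2 * N : ℝ)) := by
        apply setLIntegral_congr_fun measurableSet_Ioi
        intro t ht
        have ht0 : 0 < t := hr.trans ht
        simp only
        rw [← ENNReal.ofReal_pow ht0.le, ← ENNReal.ofReal_inv_of_pos (by positivity),
          ← ENNReal.ofReal_mul ht0.le, Real.rpow_sub ht0, Real.rpow_one]
        congr 1
        rw [div_eq_mul_inv]
        congr 2
        exact_mod_cast (Real.rpow_natCast t (2 * N)).symm
    _ = ENNReal.ofReal (∫ t in Set.Ioi r, t ^ (1 - 2 * N : ℝ)) := by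
        rw [ofReal_integral_eq_lintegral_ofReal (integrableOn_Ioi_rpow_of_lt ha hr)]
        filter_upwards [self_mem_ae_restrict measurableSet_Ioi] with t ht
        exact Real.rpow_nonneg (hr.trans ht).le _
    _ ≤ _ := by
        rw [integral_Ioi_rpow_of_lt ha hr, ← ENNReal.ofReal_pow hr.le,
          ← ENNReal.ofReal_inv_of_pos (by positivity)]
        apply ENNReal.ofReal_le_ofReal
        have e : r ^ (1 - 2 * (N:ℝ) + 1) = (r ^ (2 * N - 2))⁻¹ := by
          rw [← Real.rpow_natCast, ← Real.rpow_neg hr.le]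
          congr 1
          rw [Nat.cast_sub (by omega)]
          push_cast
          ring
        rw [e, neg_div, ← div_neg]
        apply div_le_self (by positivity)
        linarith

def tmeas (N : ℕ) : Measure (Eu N × ℝ) :=
  ((volume : Measure (Eu N)).prod (volume.restrict (Set.Ioc (0:ℝ) 1))).withDensity
    (fun p => ENNReal.ofReal p.2)

lemma lintegral_tmeas {G : Eu N × ℝ → ℝ≥0∞} (hG : Measurable G) :
    ∫⁻ p, G p ∂(tmeas N) = ∫⁻ x, ∫⁻ t in Set.Ioc (0:ℝ) 1, ENNReal.ofReal t * G (x, t) := by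
  unfold tmeas
  rw [lintegral_withDensity_eq_lintegral_mul _ (by fun_prop) hG, lintegral_prod _ (by fun_prop)]
  rfl

def semi (g : Eu N → ℝ) : ℝ≥0∞ :=
  ∫⁻ x, ∫⁻ y, ‖g x - g y‖ₑ ^ N / ‖x - y‖ₑ ^ (2 * N - 2)

lemma est_t (hN : 3 ≤ N) {w : Eu N → ℝ} (hw : WW w) (l : Fin N) : ∃ C : ℝ≥0∞, C ≠ ⊤ ∧ ∀ g : Eu N → ℝ,
    ContDiff ℝ 1 g → ∫⁻ p, ‖MW w (pd g l) p‖ₑ ^ N ∂(tmeas N) ≤ C * semi g := by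
  obtain ⟨C, hC, h⟩ := jensen hN (hw.pd l)
  refine ⟨C, hC, ?_⟩
  intro g hg
  have hgc := hg.continuous
  have hpg := (contDiff_pd (m := 0) hg (by norm_num) l).continuous
  rw [lintegral_tmeas ((MW_cont hw hpg).measurable.enorm.pow_const N)]
  unfold semi
  rw [← lintegral_const_mul' _ _ hC]
  apply lintegral_mono
  intro x
  simp only
  set G : Eu N → ℝ≥0∞ := fun y => ‖g y - g x‖ₑ ^ N with hG
  have hGm : Measurable G := by
    have : Continuous G := by fun_prop
    exact this.measurable
  have step1 : ∀ t ∈ Set.Ioc (0:ℝ) 1, ENNReal.ofReal t * ‖MW w (pd g l) (x, t)‖ₑ ^ N ≤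
      C * ∫⁻ y, {t : ℝ | ‖x - y‖ ≤ t}.indicator
        (fun t => ENNReal.ofReal t * (ENNReal.ofReal t ^ (2 * N))⁻¹) t * G y := by
    intro t ht
    have ht0 := ht.1
    have hi := MW_ibp hw hg l x t (g x)
    have hT0 : ENNReal.ofReal t ≠ 0 := by simpa using ht0
    have hTp0 : ENNReal.ofReal t ^ N ≠ 0 := pow_ne_zero _ hT0
    have hTp : ENNReal.ofReal t ^ N ≠ ⊤ := by simp
    have h1 : ENNReal.ofReal t ^ N * ‖MW w (pd g l) (x, t)‖ₑ ^ N ≤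
        C * ((ENNReal.ofReal t ^ N)⁻¹ * ∫⁻ y, {y | ‖x - y‖ ≤ t}.indicator G y) := by
      rw [← scale_ball x ht0 G hGm, ← mul_pow]
      have := h (fun z => g (x + t • z) - g x) (by fun_prop)
      refine le_trans (le_of_eq ?_) this
      rw [← enorm_neg (∫ z, _), ← hi, enorm_mul, Real.enorm_of_nonneg ht0.le]
    have h2 : ‖MW w (pd g l) (x, t)‖ₑ ^ N ≤ (ENNReal.ofReal t ^ N)⁻¹ *
        (C * ((ENNReal.ofReal t ^ N)⁻¹ * ∫⁻ y, {y | ‖x - y‖ ≤ t}.indicator G y)) := by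
      calc _ = (ENNReal.ofReal t ^ N)⁻¹ * (ENNReal.ofReal t ^ N * ‖MW w (pd g l) (x, t)‖ₑ ^ N) := by
            rw [← mul_assoc, ENNReal.inv_mul_cancel hTp0 hTp, one_mul]
        _ ≤ _ := by gcongr
    have h3 : ∫⁻ y, {t : ℝ | ‖x - y‖ ≤ t}.indicator
        (fun t => ENNReal.ofReal t * (ENNReal.ofReal t ^ (2 * N))⁻¹) t * G y = 
        (ENNReal.ofReal t * (ENNReal.ofReal t ^ (2 * N))⁻¹) *
          ∫⁻ y, {y | ‖x - y‖ ≤ t}.indicator G y := by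
      rw [← lintegral_const_mul' _ _ (by
        apply ENNReal.mul_ne_top (by simp)
        simpa using fun h => absurd h ht0.not_ge)]
      congr 1
      ext y
      by_cases hy : ‖x - y‖ ≤ t
      · rw [Set.indicator_of_mem (by exact hy), Set.indicator_of_mem (by exact hy)]
      · rw [Set.indicator_of_notMem (by exact hy), Set.indicator_of_notMem (by exact hy)]
        simp
    rw [h3]
    calc _ ≤ ENNReal.ofReal t * ((ENNReal.ofReal t ^ N)⁻¹ *
        (C * ((ENNReal.ofReal t ^ N)⁻¹ * ∫⁻ y, {y | ‖x - y‖ ≤ t}.indicator G y))) := by gcongr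
      _ = _ := by
        rw [two_mul, pow_add, ENNReal.mul_inv (Or.inl hTp0) (Or.inl hTp)]
        ring
  calc _ ≤ ∫⁻ t in Set.Ioc (0:ℝ) 1, C * ∫⁻ y, {t : ℝ | ‖x - y‖ ≤ t}.indicator
        (fun t => ENNReal.ofReal t * (ENNReal.ofReal t ^ (2 * N))⁻¹) t * G y :=
        setLIntegral_mono' measurableSet_Ioc step1
    _ = C * ∫⁻ y, ∫⁻ t in Set.Ioc (0:ℝ) 1, {t : ℝ | ‖x - y‖ ≤ t}.indicator
        (fun t => ENNReal.ofReal t * (ENNReal.ofReal t ^ (2 * N))⁻¹) t * G y := by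
        rw [lintegral_const_mul' _ _ hC, lintegral_lintegral_swap]
        apply Measurable.aemeasurable
        apply Measurable.mul
        · have : (Function.uncurry fun (t : ℝ) (y : Eu N) => {t : ℝ | ‖x - y‖ ≤ t}.indicator
            (fun t => ENNReal.ofReal t * (ENNReal.ofReal t ^ (2 * N))⁻¹) t)
            = {p : ℝ × Eu N | ‖x - p.2‖ ≤ p.1}.indicator
            (fun p => ENNReal.ofReal p.1 * (ENNReal.ofReal p.1 ^ (2 * N))⁻¹) := by
            ext p; rfl
          have h5 : Measurable (Function.uncurry fun (t : ℝ) (y : Eu N) => {t : ℝ | ‖x - y‖ ≤ t}.indicator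
            (fun t => ENNReal.ofReal t * (ENNReal.ofReal t ^ (2 * N))⁻¹) t) := by
            rw [this]
            exact Measurable.indicator (by fun_prop) (measurableSet_le (by fun_prop) (by fun_prop))
          exact h5
        · exact hGm.comp measurable_snd
    _ ≤ _ := by
        gcongr with y
        rw [lintegral_mul_const' _ _ (by simp [hG])]
        by_cases hxy : x = y
        · subst hxy
          simp [hG, show N ≠ 0 by omega]
        · have hr : 0 < ‖x - y‖ := norm_pos_iff.2 (sub_ne_zero.2 hxy)
          rw [ENNReal.div_eq_inv_mul, ← ofReal_norm (x - y)]
          refine mul_le_mul' (time_int hN hr) (le_of_eq ?_)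
          simp only [hG]
          rw [← enorm_neg, neg_sub]

end part5

section part6

open MeasureTheory Real Filter
open scoped ContDiff ENNReal
variable {N : ℕ}

def kap (N : ℕ) (L M : ℝ) (r : ℝ) : ℝ := (min (L * r) M) ^ N / r ^ (2 * N - 2)

lemma kap_int (hN : 3 ≤ N) {L M : ℝ} (hL : 0 ≤ L) (hM : 0 ≤ M) :
    Integrable (fun z : Eu N => kap N L M ‖z‖) := by
  have : Nontrivial (Eu N) := by
    have : Nonempty (Fin N) := ⟨⟨0, by omega⟩⟩
    infer_instance
  have hN' : (3:ℝ) ≤ N := by exact_mod_cast hN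
  rw [integrable_fun_norm_addHaar (volume : Measure (Eu N)) (f := kap N L M)]
  rw [finrank_euclideanSpace, Fintype.card_fin]
  have hmeas : Measurable (fun y : ℝ => y ^ (N - 1) • kap N L M y) := by
    unfold kap; fun_prop
  rw [← Set.Ioc_union_Ioi_eq_Ioi (zero_le_one' ℝ)]
  apply IntegrableOn.union
  · refine Measure.integrableOn_of_bounded (M := L ^ N) (by simp) hmeas.aestronglyMeasurable ?_
    filter_upwards [self_mem_ae_restrict measurableSet_Ioc] with r hr
    have h0 := hr.1
    have hm0 : 0 ≤ min (L * r) M := le_min (by positivity) hM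
    rw [norm_of_nonneg (by unfold kap; simp only [smul_eq_mul]; positivity)]
    unfold kap
    have : (min (L * r) M) ^ N ≤ (L * r) ^ N := pow_le_pow_left₀ hm0 (min_le_left _ _) _
    simp only [smul_eq_mul]
    calc _ ≤ r ^ (N - 1) * ((L * r) ^ N / r ^ (2 * N - 2)) := by gcongr
      _ = L ^ N * r := by
        have e : r ^ (N - 1) * r ^ N = r ^ (2 * N - 2) * r := by
          rw [← pow_add, ← pow_succ]; congr 1; omega
        rw [mul_pow, ← mul_div_assoc, div_eq_iff (by positivity)]
        linear_combination L ^ N * e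
      _ ≤ L ^ N * 1 := by gcongr; exact hr.2
      _ = L ^ N := mul_one _
  · have ha : (1 - N : ℝ) < -1 := by linarith
    refine Integrable.mono' ((integrableOn_Ioi_rpow_of_lt ha one_pos).const_mul (M ^ N))
      hmeas.aestronglyMeasurable ?_
    filter_upwards [self_mem_ae_restrict measurableSet_Ioi] with r hr
    have h0 : 0 < r := one_pos.trans hr
    have hm0 : 0 ≤ min (L * r) M := le_min (by positivity) hM
    rw [norm_of_nonneg (by unfold kap; simp only [smul_eq_mul]; positivity)]
    unfold kap
    have : (min (L * r) M) ^ N ≤ M ^ N := pow_le_pow_left₀ hm0 (min_le_right _ _) _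
    simp only [smul_eq_mul]
    calc _ ≤ r ^ (N - 1) * (M ^ N / r ^ (2 * N - 2)) := by gcongr
      _ = M ^ N * r ^ (1 - N : ℝ) := by
        have e : r ^ (2 * N - 2) = r ^ (N - 1) * r ^ (N - 1) := by
          rw [← pow_add]; congr 1; omega
        have e2 : r ^ (1 - N : ℝ) = (r ^ (N - 1))⁻¹ := by
          rw [← Real.rpow_natCast, ← Real.rpow_neg h0.le]
          congr 1
          rw [Nat.cast_sub (by omega)]
          push_cast; ring
        rw [e, e2]
        field_simp

lemma prod_int (hN : 3 ≤ N) {F : Type*} [NormedAddCommGroup F] {D : Eu N → F}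
    (hD : Continuous D) (hDs : HasCompactSupport D) {K : NNReal} (hK : LipschitzWith K D) :
    Integrable (fun p : Eu N × Eu N => ‖D p.1 - D p.2‖ ^ N / ‖p.1 - p.2‖ ^ (2 * N - 2))
      (volume.prod volume) := by
  obtain ⟨M, hM⟩ := hD.bounded_above_of_compact_support hDs
  have hM0 : 0 ≤ M := (norm_nonneg _).trans (hM 0)
  set S := tsupport D with hS
  have hSm : MeasurableSet S := (isClosed_tsupport D).measurableSet
  have hk := kap_int hN (L := K) (M := 2 * M) K.2 (by positivity)
  have hind : Integrable (S.indicator (fun _ : Eu N => (1:ℝ))) :=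
    (integrable_indicator_iff hSm).2 (integrableOn_const (hDs.isCompact.measure_lt_top.ne))
  have I1 := Integrable.convolution_integrand (ContinuousLinearMap.mul ℝ ℝ) hind hk
  have I2 := I1.swap
  refine Integrable.mono' (I1.add I2) ?_ ?_
  · apply Measurable.aestronglyMeasurable
    have h1 : Continuous fun p : Eu N × Eu N => ‖D p.1 - D p.2‖ ^ N := by fun_prop
    have h2 : Continuous fun p : Eu N × Eu N => ‖p.1 - p.2‖ ^ (2 * N - 2) := by fun_prop
    exact h1.measurable.div h2.measurable
  · refine Eventually.of_forall ?_
    rintro ⟨x, y⟩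
    rw [norm_of_nonneg (by positivity)]
    simp only [Pi.add_apply, Function.comp_apply, Prod.fst_swap, Prod.snd_swap,
      ContinuousLinearMap.mul_apply']
    rw [norm_sub_rev y x, ← add_mul]
    have hk0 : 0 ≤ kap N K (2 * M) ‖x - y‖ := by
      unfold kap
      have : 0 ≤ min (K * ‖x - y‖) (2 * M) := le_min (by positivity) (by positivity)
      positivity
    by_cases h : D x = 0 ∧ D y = 0
    · rw [h.1, h.2]
      simp only [sub_self, norm_zero, zero_pow (show N ≠ 0 by omega), zero_div]
      apply mul_nonneg _ hk0
      apply add_nonneg <;> exact Set.indicator_nonneg (by simp) _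
    · have hb : ‖D x - D y‖ ^ N / ‖x - y‖ ^ (2 * N - 2) ≤ kap N K (2 * M) ‖x - y‖ := by
        unfold kap
        gcongr
        refine le_min (hK.norm_sub_le x y) ?_
        calc _ ≤ ‖D x‖ + ‖D y‖ := norm_sub_le _ _
          _ ≤ _ := by linarith [hM x, hM y]
      refine hb.trans (le_mul_of_one_le_left hk0 ?_)
      have n1 : ∀ z, 0 ≤ S.indicator (fun _ : Eu N => (1:ℝ)) z :=
        fun z => Set.indicator_nonneg (by simp) _
      have n2 : ∀ z, D z ≠ 0 → S.indicator (fun _ : Eu N => (1:ℝ)) z = 1 := fun z hz =>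
        Set.indicator_of_mem (subset_tsupport _ hz) _
      by_cases hx : D x = 0
      · have hy : D y ≠ 0 := fun hy => h ⟨hx, hy⟩
        linarith [n1 x, n2 y hy]
      · linarith [n1 y, n2 x hx]

lemma norm_ebasis (i : Fin N) : ‖(ebasis i : Eu N)‖ = 1 := by simp [ebasis]

lemma pow_root (hN : 3 ≤ N) {I b : ℝ} (hI : 0 ≤ I) (h : I ^ (1 / (N:ℝ)) ≤ b) :
    ENNReal.ofReal I ≤ ENNReal.ofReal b ^ N := by
  have hb : 0 ≤ b := (Real.rpow_nonneg hI _).trans h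
  rw [← ENNReal.ofReal_pow hb]
  apply ENNReal.ofReal_le_ofReal
  calc I = (I ^ (1 / (N:ℝ))) ^ N := by
        rw [← Real.rpow_natCast, ← Real.rpow_mul hI, one_div_mul_cancel, Real.rpow_one]
        exact_mod_cast (by omega : N ≠ 0)
    _ ≤ b ^ N := by gcongr

lemma besov_link (hN : 3 ≤ N) {v : Eu N → ℝ} (hv : ContDiff ℝ 2 v) (hvs : HasCompactSupport v) :
    (∀ k, ∫⁻ x, ‖pd v k x‖ₑ ^ N ≤ ENNReal.ofReal (besov N (2 - 2/(N:ℝ)) N v) ^ N) ∧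
    (∀ k, semi (pd v k) ≤ ENNReal.ofReal (besov N (2 - 2/(N:ℝ)) N v) ^ N) := by
  have hN0 : (N:ℝ) ≠ 0 := by exact_mod_cast (by omega : N ≠ 0)
  have hD : ContDiff ℝ 1 (fderiv ℝ v) := hv.fderiv_right (by norm_num)
  have hDs : HasCompactSupport (fderiv ℝ v) := hvs.fderiv ℝ
  obtain ⟨K, hK⟩ := hD.lipschitzWith_of_hasCompactSupport hDs (by norm_num)
  have hP := prod_int hN hD.continuous hDs hK
  have eexp : (N : ℝ) + ((2 - 2/(N:ℝ)) - 1) * N = ((2 * N - 2 : ℕ) : ℝ) := by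
    rw [Nat.cast_sub (by omega)]; push_cast; field_simp; ring
  set A := (∫ x : Eu N, |v x| ^ (N:ℝ)) with hA
  set B := (∫ x : Eu N, ‖fderiv ℝ v x‖ ^ N) with hB
  set C := (∫ x : Eu N, ∫ y : Eu N,
      ‖fderiv ℝ v x - fderiv ℝ v y‖ ^ N / ‖x - y‖ ^ (2 * N - 2)) with hC
  have hA0 : 0 ≤ A := integral_nonneg fun x => by positivity
  have hB0 : 0 ≤ B := integral_nonneg fun x => by positivity
  have hC0 : 0 ≤ C := integral_nonneg fun x => integral_nonneg fun y => by positivity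
  have hb : besov N (2 - 2/(N:ℝ)) N v = A ^ (1/(N:ℝ)) + B ^ (1/(N:ℝ)) + C ^ (1/(N:ℝ)) := by
    unfold besov
    simp only [eexp, Real.rpow_natCast, hA, hB, hC]
  set b := besov N (2 - 2/(N:ℝ)) N v with hbdef
  have pA := Real.rpow_nonneg hA0 (1/(N:ℝ))
  have pB := Real.rpow_nonneg hB0 (1/(N:ℝ))
  have pC := Real.rpow_nonneg hC0 (1/(N:ℝ))
  have hpd : ∀ k x, ‖pd v k x‖ ≤ ‖fderiv ℝ v x‖ := fun k x => by
    have := (fderiv ℝ v x).le_opNorm (ebasis k)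
    rwa [norm_ebasis, mul_one] at this
  have hpd2 : ∀ k x y, ‖pd v k x - pd v k y‖ ≤ ‖fderiv ℝ v x - fderiv ℝ v y‖ := fun k x y => by
    have := (fderiv ℝ v x - fderiv ℝ v y).le_opNorm (ebasis k)
    rwa [norm_ebasis, mul_one] at this
  constructor
  · intro k
    refine le_trans ?_ (pow_root hN hB0 (b := b) (by linarith))
    have hIntg : Integrable (fun x => ‖fderiv ℝ v x‖ ^ N) := by
      apply Continuous.integrable_of_hasCompactSupport
      · have := hD.continuous; fun_prop
      · exact hDs.norm.comp_left (g := fun r : ℝ => r ^ N) (zero_pow (by omega))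
    rw [hB, ofReal_integral_eq_lintegral_ofReal hIntg (Eventually.of_forall fun x => by positivity)]
    apply lintegral_mono
    intro x
    simp only
    rw [← ofReal_norm, ← ENNReal.ofReal_pow (norm_nonneg _)]
    apply ENNReal.ofReal_le_ofReal
    gcongr
    exact hpd k x
  · intro k
    refine le_trans ?_ (pow_root hN hC0 (b := b) (by linarith))
    have e : C = ∫ p : Eu N × Eu N, ‖fderiv ℝ v p.1 - fderiv ℝ v p.2‖ ^ N / ‖p.1 - p.2‖ ^ (2 * N - 2)
       ∂(volume.prod volume) := (integral_prod _ hP).symm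
    rw [e, ofReal_integral_eq_lintegral_ofReal hP (Eventually.of_forall fun x => by positivity),
      lintegral_prod _ hP.1.aemeasurable.ennreal_ofReal]
    unfold semi
    apply lintegral_mono
    intro x
    apply lintegral_mono
    intro y
    simp only
    by_cases hxy : x = y
    · subst hxy
      simp [show N ≠ 0 by omega]
    · have hr : 0 < ‖x - y‖ := norm_pos_iff.2 (sub_ne_zero.2 hxy)
      rw [← ofReal_norm, ← ofReal_norm, ← ENNReal.ofReal_pow (norm_nonneg _),
        ← ENNReal.ofReal_pow (norm_nonneg _), ← ENNReal.ofReal_div_of_pos (by positivity)]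
      apply ENNReal.ofReal_le_ofReal
      gcongr
      exact hpd2 k x y

end part6

section part7

open MeasureTheory Real Filter
open scoped ContDiff ENNReal Topology
variable {N : ℕ}

/-- `f k` converges in `L^p`. -/
def LC {α : Type*} [MeasurableSpace α] (p : ℝ≥0∞) (μ : Measure α) (f : ℕ → α → ℝ) : Prop :=
  (∀ k, MemLp (f k) p μ) ∧ ∃ g, MemLp g p μ ∧
    Tendsto (fun k => eLpNorm (f k - g) p μ) atTop (𝓝 0)

section LCsec
variable {α : Type*} [MeasurableSpace α] {μ : Measure α} {p q r : ℝ≥0∞} {f g : ℕ → α → ℝ}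

lemma LC.congr (hf : LC p μ f) (h : ∀ k x, g k x = f k x) : LC p μ g := by
  have : g = f := funext fun k => funext fun x => h k x
  rwa [this]

lemma LC.const {h : α → ℝ} (hh : MemLp h p μ) : LC p μ (fun _ => h) :=
  ⟨fun _ => hh, h, hh, by simp⟩

lemma LC.mul (hr : 1 ≤ r) (hpqr : p.HolderTriple q r) (hf : LC p μ f) (hg : LC q μ g) :
    LC r μ (fun k x => f k x * g k x) := by
  obtain ⟨hf1, F, hF, hf2⟩ := hf
  obtain ⟨hg1, G, hG, hg2⟩ := hg
  refine ⟨fun k => (hg1 k).mul (hf1 k), F * G, hG.mul hF, ?_⟩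
  have hb : ∀ k, eLpNorm ((fun x => f k x * g k x) - F * G) r μ ≤
      eLpNorm (f k - F) p μ * eLpNorm (g k - G) q μ + eLpNorm (f k - F) p μ * eLpNorm G q μ
      + eLpNorm F p μ * eLpNorm (g k - G) q μ := by
    intro k
    have mf := ((hf1 k).sub hF).1
    have mg := ((hg1 k).sub hG).1
    have e : ((fun x => f k x * g k x) - F * G) =
      ((f k - F) • (g k - G) + (f k - F) • G) + F • (g k - G) := by
      ext x; simp; ring
    rw [e]
    refine (eLpNorm_add_le ((mf.smul mg).add (mf.smul hG.1)) (hF.1.smul mg) hr).trans ?_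
    gcongr
    · refine (eLpNorm_add_le (mf.smul mg) (mf.smul hG.1) hr).trans ?_
      gcongr
      · exact eLpNorm_smul_le_mul_eLpNorm mg mf
      · exact eLpNorm_smul_le_mul_eLpNorm hG.1 mf
    · exact eLpNorm_smul_le_mul_eLpNorm mg hF.1
  refine tendsto_of_tendsto_of_tendsto_of_le_of_le tendsto_const_nhds ?_ (fun _ => zero_le) hb
  have t1 := ENNReal.Tendsto.mul hf2 (Or.inr ENNReal.zero_ne_top) hg2 (Or.inr ENNReal.zero_ne_top)
  have t2 := ENNReal.Tendsto.mul_const hf2 (b := eLpNorm G q μ) (Or.inr hG.2.ne)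
  have t3 := ENNReal.Tendsto.const_mul hg2 (a := eLpNorm F p μ) (Or.inr hF.2.ne)
  simpa using (t1.add t2).add t3

lemma LC.add (hp : 1 ≤ p) (hf : LC p μ f) (hg : LC p μ g) :
    LC p μ (fun k x => f k x + g k x) := by
  obtain ⟨hf1, F, hF, hf2⟩ := hf
  obtain ⟨hg1, G, hG, hg2⟩ := hg
  refine ⟨fun k => (hf1 k).add (hg1 k), F + G, hF.add hG, ?_⟩
  have hb : ∀ k, eLpNorm ((fun x => f k x + g k x) - (F + G)) p μ ≤
      eLpNorm (f k - F) p μ + eLpNorm (g k - G) p μ := by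
    intro k
    have e : ((fun x => f k x + g k x) - (F + G)) = (f k - F) + (g k - G) := by
      ext x; simp; ring
    rw [e]
    exact eLpNorm_add_le ((hf1 k).sub hF).1 ((hg1 k).sub hG).1 hp
  refine tendsto_of_tendsto_of_tendsto_of_le_of_le tendsto_const_nhds ?_ (fun _ => zero_le) hb
  simpa using hf2.add hg2

lemma LC.sum (hp : 1 ≤ p) {ι : Type*} (s : Finset ι) {f : ι → ℕ → α → ℝ} (hf : ∀ i ∈ s, LC p μ (f i)) :
    LC p μ (fun k x => ∑ i ∈ s, f i k x) := by
  classical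
  induction s using Finset.induction_on with
  | empty => exact (LC.const (MemLp.zero' )).congr (by simp)
  | insert a s ha ih =>
    refine (LC.add hp (hf a (by simp)) (ih fun i hi => hf i (by simp [hi]))).congr ?_
    intro k x
    rw [Finset.sum_insert ha]

lemma LC.bmul (hp : 1 ≤ p) (hf : LC p μ f) {h : α → ℝ} (hh : MemLp h ⊤ μ) :
    LC p μ (fun k x => h x * f k x) :=
  LC.mul hp inferInstance (LC.const hh) hf

lemma LC.cmul (hp : 1 ≤ p) (hf : LC p μ f) (c : ℝ) : LC p μ (fun k x => c * f k x) :=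
  LC.bmul hp hf (memLp_top_const c)

lemma LC.sub (hp : 1 ≤ p) (hf : LC p μ f) (hg : LC p μ g) :
    LC p μ (fun k x => f k x - g k x) :=
  (LC.add hp hf (hg.cmul hp (-1))).congr fun k x => by ring

lemma LC.prod (hN : 0 < N) {ι : Type*} (s : Finset ι) (hs : s.card ≤ N) {f : ι → ℕ → α → ℝ}
    (hf : ∀ i ∈ s, LC N μ (f i)) :
    LC ((N : ℝ≥0∞) / s.card) μ (fun k x => ∏ i ∈ s, f i k x) := by
  classical
  have hN0 : (N : ℝ≥0∞) ≠ 0 := by simpa using hN.ne'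
  induction s using Finset.induction_on with
  | empty =>
    simp only [Finset.card_empty, Nat.cast_zero, Finset.prod_empty]
    rw [ENNReal.div_zero hN0]
    exact LC.const (memLp_top_const 1)
  | insert a s ha ih =>
    rw [Finset.card_insert_of_notMem ha] at hs ⊢
    refine (LC.mul ?_ ?_ (ih (by omega) fun i hi => hf i (by simp [hi])) (hf a (by simp))).congr ?_
    · rw [ENNReal.le_div_iff_mul_le (by simp) (by simp), one_mul]
      exact_mod_cast hs
    · constructor
      rw [ENNReal.inv_div (by simp) (by simp [hN0]), ENNReal.inv_div (by simp) (by simp [hN0])]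
      push_cast
      rw [ENNReal.add_div, one_div]
    · intro k x
      rw [Finset.prod_insert ha, mul_comm]

lemma LC.det (hN : 0 < N) {M : ℕ → α → Matrix (Fin N) (Fin N) ℝ}
    (h : ∀ i j, LC N μ (fun k x => M k x i j)) : LC 1 μ (fun k x => (M k x).det) := by
  have hN0 : (N : ℝ≥0∞) ≠ 0 := by simpa using hN.ne'
  have : LC 1 μ (fun k x => ∑ σ : Equiv.Perm (Fin N), ((Equiv.Perm.sign σ : ℤ) : ℝ) *
      ∏ l, M k x l (σ l)) := by
    refine LC.sum le_rfl _ fun σ _ => LC.cmul le_rfl ?_ _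
    have := LC.prod hN (Finset.univ : Finset (Fin N)) (by simp) (f := fun l k x => M k x l (σ l))
      (fun i _ => h i (σ i)) (μ := μ)
    simpa [ENNReal.div_self hN0] using this
  exact this.congr fun k x => det_row _

lemma LC.integral (hf : LC 1 μ f) : ∃ L, Tendsto (fun k => ∫ x, f k x ∂μ) atTop (𝓝 L) := by
  obtain ⟨h1, g, hg, h2⟩ := hf
  exact ⟨_, tendsto_integral_of_L1' g hg.1 (Eventually.of_forall fun k => memLp_one_iff_integrable.1 (h1 k)) h2⟩

lemma LC.of_cauchy (hp : 1 ≤ p) (hm : ∀ k, MemLp (f k) p μ)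
    (h : Tendsto (fun n : ℕ × ℕ => eLpNorm (f n.1 - f n.2) p μ) atTop (𝓝 0)) : LC p μ f := by
  have : Fact (1 ≤ p) := ⟨hp⟩
  refine ⟨hm, ?_⟩
  have hc : CauchySeq (fun k => (hm k).toLp (f k)) := by
    rw [Lp.cauchySeq_Lp_iff_cauchySeq_eLpNorm]
    refine h.congr fun n => ?_
    apply eLpNorm_congr_ae
    exact ((hm n.1).coeFn_toLp.sub (hm n.2).coeFn_toLp).symm
  obtain ⟨G, hG⟩ := cauchySeq_tendsto_of_complete hc
  refine ⟨G, Lp.memLp G, ?_⟩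
  rw [← Lp.tendsto_Lp_iff_tendsto_eLpNorm'' f hm G (Lp.memLp G)]
  simpa using hG

lemma LC.of_bound (hN : 3 ≤ N) (hmeas : ∀ k, AEStronglyMeasurable (f k) μ)
    (hfin : ∀ k, ∫⁻ x, ‖f k x‖ₑ ^ N ∂μ ≠ ⊤) {b : ℕ → ℕ → ℝ}
    (hb : ∀ ε : ℝ, 0 < ε → ∃ M : ℕ, ∀ m n : ℕ, M ≤ m → M ≤ n → b m n < ε)
    {C : ℝ≥0∞} (hC : C ≠ ⊤)
    (h : ∀ m n, ∫⁻ x, ‖f m x - f n x‖ₑ ^ N ∂μ ≤ C * ENNReal.ofReal (b m n) ^ N) : LC N μ f := by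
  have hN0 : (N : ℝ≥0∞) ≠ 0 := by simpa using (by omega : N ≠ 0)
  have key : ∀ F : α → ℝ, eLpNorm F N μ = (∫⁻ x, ‖F x‖ₑ ^ N ∂μ) ^ (1 / (N:ℝ)) := by
    intro F
    rw [eLpNorm_eq_lintegral_rpow_enorm_toReal hN0 (by simp)]
    simp
  have hb0 : Tendsto (fun n : ℕ × ℕ => ENNReal.ofReal (b n.1 n.2)) atTop (𝓝 0) := by
    rw [ENNReal.tendsto_nhds_zero]
    intro ε hε
    obtain ⟨δ, hδ, hδε⟩ : ∃ δ : ℝ, 0 < δ ∧ ENNReal.ofReal δ ≤ ε := by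
      by_cases he : ε = ⊤
      · exact ⟨1, one_pos, by simp [he]⟩
      · exact ⟨ε.toReal, ENNReal.toReal_pos hε.ne' he, by rw [ENNReal.ofReal_toReal he]⟩
    obtain ⟨M, hM⟩ := hb δ hδ
    filter_upwards [eventually_ge_atTop (M, M)] with n hn
    exact (ENNReal.ofReal_le_ofReal (hM _ _ hn.1 hn.2).le).trans hδε
  have hNi : (0:ℝ) < 1 / (N:ℝ) := by
    have : (0:ℝ) < N := by exact_mod_cast (by omega : 0 < N)
    positivity
  refine LC.of_cauchy (by exact_mod_cast (by omega : 1 ≤ N)) (fun k => ⟨hmeas k, ?_⟩) ?_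
  · rw [key]
    exact ENNReal.rpow_lt_top_of_nonneg hNi.le (hfin k)
  · have t1 : Tendsto (fun n : ℕ × ℕ => (C * ENNReal.ofReal (b n.1 n.2) ^ N) ^ (1 / (N:ℝ))) atTop
        (𝓝 ((C * 0 ^ N) ^ (1 / (N:ℝ)))) :=
      (ENNReal.Tendsto.const_mul (ENNReal.Tendsto.pow hb0) (Or.inr hC)).ennrpow_const _
    rw [zero_pow (by omega), mul_zero, ENNReal.zero_rpow_of_pos hNi] at t1
    refine tendsto_of_tendsto_of_tendsto_of_le_of_le tendsto_const_nhds t1 (fun _ => zero_le) ?_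
    intro n
    simp only [key]
    gcongr
    exact h n.1 n.2

end LCsec

end part7

section part8

open MeasureTheory Real Filter
open scoped ContDiff ENNReal Topology
variable {N : ℕ}

lemma MW_dd2 {ρ u : Eu N → ℝ} (hρ : WW ρ) (hu : ContDiff ℝ 2 u) (hus : HasCompactSupport u)
    (a b : Eu N × ℝ) : dd a (dd b (MW ρ u)) = fun p => ∑ k, ∑ l,
      MW (fun z => ρ z * lam b k z * lam a l z) (pd (pd u k) l) p := by
  rw [MW_dd hρ (hu.of_le (by norm_num)) hus b]
  ext p
  have h : ∀ k, _ := fun k => MW_dd_aux (hρ.lam b k) (contDiff_pd (m := 1) hu (by norm_num) k)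
    (hasCompactSupport_pd hus k) a p
  have e : dd a (fun p => ∑ k, MW (fun z => ρ z * lam b k z) (pd u k) p) p
      = ∑ k, dd a (MW (fun z => ρ z * lam b k z) (pd u k)) p := by
    unfold dd
    rw [fderiv_fun_sum (fun k _ => (h k).1)]
    simp
  rw [e]
  exact Finset.sum_congr rfl fun k _ => (h k).2

lemma cont_pd2 {u : Eu N → ℝ} (hu : ContDiff ℝ 2 u) (k l : Fin N) : Continuous (pd (pd u k) l) :=
  (contDiff_pd (m := 0) (contDiff_pd (m := 1) hu (by norm_num) k) (by norm_num) l).continuous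

lemma cont_dd2 {ρ u : Eu N → ℝ} (hρ : WW ρ) (hu : ContDiff ℝ 2 u) (hus : HasCompactSupport u)
    (a b : Eu N × ℝ) : Continuous (dd a (dd b (MW ρ u))) := by
  rw [MW_dd2 hρ hu hus]
  exact continuous_finsetSum _ fun k _ => continuous_finsetSum _ fun l _ =>
    MW_cont ((hρ.lam b k).lam a l) (cont_pd2 hu k l)

lemma cont_dd1 {ρ u : Eu N → ℝ} (hρ : WW ρ) (hu : ContDiff ℝ 2 u) (hus : HasCompactSupport u)
    (b : Eu N × ℝ) : Continuous (dd b (MW ρ u)) := by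
  rw [MW_dd hρ (hu.of_le (by norm_num)) hus b]
  exact continuous_finsetSum _ fun k _ =>
    MW_cont (hρ.lam b k) (contDiff_pd (m := 1) hu (by norm_num) k).continuous

lemma MW_sub {w f g : Eu N → ℝ} (hw : WW w) (hf : Continuous f) (hg : Continuous g) (p : Eu N × ℝ) :
    MW w f p - MW w g p = MW w (fun x => f x - g x) p := by
  have hi : ∀ f : Eu N → ℝ, Continuous f → Integrable (fun z => w z * f (p.1 + p.2 • z)) := by
    intro f hf
    apply Continuous.integrable_of_hasCompactSupport
    · have := hw.cont
      fun_prop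
    · exact hw.hcs.mul_right
  unfold MW
  rw [← integral_sub (hi f hf) (hi g hg)]
  congr 1
  ext z
  ring

lemma pd_sub {f g : Eu N → ℝ} (hf : ContDiff ℝ 1 f) (hg : ContDiff ℝ 1 g) (k : Fin N) :
    pd (fun x => f x - g x) k = fun x => pd f k x - pd g k x := by
  ext x
  unfold pd
  rw [fderiv_fun_sub (hf.differentiable (by norm_num) x) (hg.differentiable (by norm_num) x)]
  rfl

lemma MW_one {w g : Eu N → ℝ} (hw : WW w) (hg : ContDiff ℝ 1 g) (l : Fin N) (x : Eu N) :
    MW w (pd g l) (x, 1) = - MW (pd w l) g (x, 1) := by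
  have := MW_ibp hw hg l x 1 0
  simpa [MW] using this

lemma MW_t0 (w g : Eu N → ℝ) (x : Eu N) : MW w g (x, 0) = (∫ z, w z) * g x := by
  simp [MW, integral_mul_const]

lemma HM_zero {ρ u : Eu N → ℝ} (hρ : WW ρ) (h1 : ∫ z, ρ z = 1) (hu : ContDiff ℝ 2 u)
    (hus : HasCompactSupport u) (x : Eu N) (i j : Fin N) :
    HM (MW ρ u) (x, 0) i j = pd (pd u i) j x := by
  have e : ∀ i k (z : Eu N), lam (ex i) k z = if k = i then 1 else 0 := by
    intro i k z
    simp [lam, ex, ebasis, Pi.single_apply]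
  unfold HM
  rw [Matrix.of_apply, MW_dd2 hρ hu hus]
  simp only [MW_t0, e]
  rw [Finset.sum_eq_single i, Finset.sum_eq_single j]
  · simp [h1]
  · intro l _ hl; simp [hl]
  · simp
  · intro k _ hk; simp [hk]
  · simp

lemma F0_zero_eq {ρ u φ : Eu N → ℝ} (hρ : WW ρ) (h1 : ∫ z, ρ z = 1) (hu : ContDiff ℝ 2 u)
    (hus : HasCompactSupport u) (x : Eu N) : F0 (MW ρ u) φ (x, 0) = hessDet u x * φ x := by
  unfold F0 hessDet
  rw [mul_comm, ← Matrix.det_transpose]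
  congr 2
  ext i j
  rw [Matrix.transpose_apply, HM_zero hρ h1 hu hus]
  rfl

section seq
variable {u : ℕ → Eu N → ℝ}

def Cau (u : ℕ → Eu N → ℝ) : Prop := ∀ ε : ℝ, 0 < ε → ∃ M : ℕ, ∀ m n : ℕ, M ≤ m → M ≤ n →
      besov N (2 - 2/(N:ℝ)) N (fun x => u m x - u n x) < ε

lemma LC_t (hN : 3 ≤ N) (hu : ∀ k, ContDiff ℝ 2 (u k)) (hus : ∀ k, HasCompactSupport (u k))
    (hc : Cau u) {w : Eu N → ℝ} (hw : WW w) (k l : Fin N) :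
    LC N (tmeas N) (fun n => MW w (pd (pd (u n) k) l)) := by
  obtain ⟨C, hC, h⟩ := est_t hN hw l
  refine LC.of_bound hN (fun n => (MW_cont hw (cont_pd2 (hu n) k l)).aestronglyMeasurable) ?_ hc hC ?_
  · intro n
    refine ne_top_of_le_ne_top ?_ (h _ (contDiff_pd (m := 1) (hu n) (by norm_num) k))
    exact ENNReal.mul_ne_top hC (ne_top_of_le_ne_top (by simp) ((besov_link hN (hu n) (hus n)).2 k))
  · intro m n
    have hd : ContDiff ℝ 2 (fun x => u m x - u n x) := (hu m).sub (hu n)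
    have hds : HasCompactSupport (fun x => u m x - u n x) := (hus m).sub (hus n)
    have e : ∀ p, MW w (pd (pd (u m) k) l) p - MW w (pd (pd (u n) k) l) p =
        MW w (pd (pd (fun x => u m x - u n x) k) l) p := by
      intro p
      rw [MW_sub hw (cont_pd2 (hu m) k l) (cont_pd2 (hu n) k l),
        pd_sub ((hu m).of_le (by norm_num)) ((hu n).of_le (by norm_num)),
        pd_sub (contDiff_pd (m := 1) (hu m) (by norm_num) k) (contDiff_pd (m := 1) (hu n) (by norm_num) k)]
    simp only [e]
    refine (h _ (contDiff_pd (m := 1) hd (by norm_num) k)).trans ?_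
    gcongr
    exact (besov_link hN hd hds).2 k

lemma LC_1 (hN : 3 ≤ N) (hu : ∀ k, ContDiff ℝ 2 (u k)) (hus : ∀ k, HasCompactSupport (u k))
    (hc : Cau u) {w : Eu N → ℝ} (hw : WW w) (k : Fin N) :
    LC N volume (fun n x => MW w (pd (u n) k) (x, 1)) := by
  obtain ⟨C, hC, h⟩ := est_one hN hw
  have hp : ∀ n, Continuous (pd (u n) k) := fun n => (contDiff_pd (m := 1) (hu n) (by norm_num) k).continuous
  refine LC.of_bound hN (fun n => ((MW_cont hw (hp n)).comp (by fun_prop)).aestronglyMeasurable) ?_ hc hC ?_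
  · intro n
    refine ne_top_of_le_ne_top ?_ (h _ (hp n))
    exact ENNReal.mul_ne_top hC (ne_top_of_le_ne_top (by simp) ((besov_link hN (hu n) (hus n)).1 k))
  · intro m n
    have hd : ContDiff ℝ 2 (fun x => u m x - u n x) := (hu m).sub (hu n)
    have hds : HasCompactSupport (fun x => u m x - u n x) := (hus m).sub (hus n)
    have e : ∀ p, MW w (pd (u m) k) p - MW w (pd (u n) k) p =
        MW w (pd (fun x => u m x - u n x) k) p := by
      intro p
      rw [MW_sub hw (hp m) (hp n),
        pd_sub ((hu m).of_le (by norm_num)) ((hu n).of_le (by norm_num))]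
    simp only [e]
    refine (h _ (contDiff_pd (m := 1) hd (by norm_num) k).continuous).trans ?_
    gcongr
    exact (besov_link hN hd hds).1 k

lemma oneN (hN : 3 ≤ N) : (1 : ℝ≥0∞) ≤ N := by exact_mod_cast (by omega : 1 ≤ N)

lemma LC_1' (hN : 3 ≤ N) (hu : ∀ k, ContDiff ℝ 2 (u k)) (hus : ∀ k, HasCompactSupport (u k))
    (hc : Cau u) {w : Eu N → ℝ} (hw : WW w) (k l : Fin N) :
    LC N volume (fun n x => MW w (pd (pd (u n) k) l) (x, 1)) := by
  refine ((LC_1 hN hu hus hc (hw.pd l) k).cmul (oneN hN) (-1)).congr fun n x => ?_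
  rw [MW_one hw (contDiff_pd (m := 1) (hu n) (by norm_num) k)]
  ring

variable {ρ : Eu N → ℝ}

lemma LC_dd_t (hN : 3 ≤ N) (hu : ∀ k, ContDiff ℝ 2 (u k)) (hus : ∀ k, HasCompactSupport (u k))
    (hc : Cau u) (hρ : WW ρ) (a b : Eu N × ℝ) :
    LC N (tmeas N) (fun n p => dd a (dd b (MW ρ (u n))) p) := by
  refine (LC.sum (oneN hN) Finset.univ fun k _ => LC.sum (oneN hN) Finset.univ fun l _ =>
    LC_t hN hu hus hc ((hρ.lam b k).lam a l) k l).congr fun n p => ?_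
  rw [MW_dd2 hρ (hu n) (hus n)]

lemma LC_dd_1 (hN : 3 ≤ N) (hu : ∀ k, ContDiff ℝ 2 (u k)) (hus : ∀ k, HasCompactSupport (u k))
    (hc : Cau u) (hρ : WW ρ) (a b : Eu N × ℝ) :
    LC N volume (fun n x => dd a (dd b (MW ρ (u n))) (x, 1)) := by
  refine (LC.sum (oneN hN) Finset.univ fun k _ => LC.sum (oneN hN) Finset.univ fun l _ =>
    LC_1' hN hu hus hc ((hρ.lam b k).lam a l) k l).congr fun n p => ?_
  rw [MW_dd2 hρ (hu n) (hus n)]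

lemma LC_d_1 (hN : 3 ≤ N) (hu : ∀ k, ContDiff ℝ 2 (u k)) (hus : ∀ k, HasCompactSupport (u k))
    (hc : Cau u) (hρ : WW ρ) (b : Eu N × ℝ) :
    LC N volume (fun n x => dd b (MW ρ (u n)) (x, 1)) := by
  refine (LC.sum (oneN hN) Finset.univ fun k _ => 
    LC_1 hN hu hus hc (hρ.lam b k) k).congr fun n p => ?_
  rw [MW_dd hρ ((hu n).of_le (by norm_num)) (hus n)]

end seq

section updr
variable {α : Type*} [MeasurableSpace α] {μ : Measure α}

lemma LC.updateRow {p : ℝ≥0∞} {M : ℕ → α → Matrix (Fin N) (Fin N) ℝ} {r : ℕ → α → Fin N → ℝ}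
    (h : ∀ i j, LC p μ (fun k x => M k x i j)) (i : Fin N) (hr : ∀ j, LC p μ (fun k x => r k x j)) :
    ∀ i' j, LC p μ (fun k x => (M k x).updateRow i (r k x) i' j) := by
  intro i' j
  by_cases hi : i' = i
  · subst hi
    exact (hr j).congr fun k x => by simp
  · exact (h i' j).congr fun k x => by simp [Matrix.updateRow_ne hi]

lemma LC.det1 (hN : 3 ≤ N) {M : ℕ → α → Matrix (Fin N) (Fin N) ℝ} {s : ℕ → α → ℝ} {g : α → Fin N → ℝ}
    (h : ∀ i j, LC N μ (fun k x => M k x i j)) (hs : LC N μ s) (hg : ∀ l, MemLp (fun x => g x l) ⊤ μ)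
    (j : Fin N) : LC 1 μ (fun k x => s k x * ((M k x).updateRow j (g x)).det) := by
  refine (LC.det (by omega) (LC.updateRow h j (r := fun k x => s k x • g x) ?_)).congr ?_
  · intro l
    exact (hs.bmul (oneN hN) (hg l)).congr fun k x => by simp [mul_comm]
  · intro k x
    rw [Matrix.det_updateRow_smul]

lemma LC.det2 (hN : 3 ≤ N) {M : ℕ → α → Matrix (Fin N) (Fin N) ℝ} {s : ℕ → α → ℝ} {g : α → Fin N → ℝ}
    {r : ℕ → α → Fin N → ℝ} 
    (h : ∀ i j, LC N μ (fun k x => M k x i j)) (hs : LC N μ s) (hg : ∀ l, MemLp (fun x => g x l) ⊤ μ)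
    (hr : ∀ j, LC N μ (fun k x => r k x j))
    (i j : Fin N) (hij : i ≠ j) :
    LC 1 μ (fun k x => s k x * (((M k x).updateRow j (g x)).updateRow i (r k x)).det) := by
  refine (LC.det1 hN (LC.updateRow h i hr) hs hg j).congr fun k x => ?_
  rw [Matrix.updateRow_comm _ hij]

end updr

end part8

section part9

open MeasureTheory Real Filter
open scoped ContDiff ENNReal Topology
section fin
variable {N : ℕ} {u : ℕ → Eu N → ℝ} {φ ρ : Eu N → ℝ}

lemma gp_bdd (hφ : ContDiff ℝ 2 φ) (hφs : HasCompactSupport φ) (j l : Fin N) :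
    ∃ C, ∀ x, ‖gp φ j x l‖ ≤ C :=
  (cont_pd2 hφ j l).bounded_above_of_compact_support
    (hasCompactSupport_pd (hasCompactSupport_pd hφs j) l)

lemma LC_F0 (hN : 3 ≤ N) (hu : ∀ k, ContDiff ℝ 2 (u k)) (hus : ∀ k, HasCompactSupport (u k))
    (hc : Cau u) (hρ : WW ρ) (hφ : ContDiff ℝ 2 φ) (hφs : HasCompactSupport φ) :
    LC 1 volume (fun n x => F0 (MW ρ (u n)) φ (x, 1)) := by
  unfold F0
  refine LC.bmul le_rfl (LC.det (by omega) fun i j => LC_dd_1 hN hu hus hc hρ _ _) ?_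
  exact hφ.continuous.memLp_top_of_hasCompactSupport hφs _

lemma LC_F1 (hN : 3 ≤ N) (hu : ∀ k, ContDiff ℝ 2 (u k)) (hus : ∀ k, HasCompactSupport (u k))
    (hc : Cau u) (hρ : WW ρ) (hφ : ContDiff ℝ 2 φ) (hφs : HasCompactSupport φ) :
    LC 1 volume (fun n x => F1 (MW ρ (u n)) φ (x, 1)) := by
  unfold F1
  simp only [Finset.mul_sum]
  refine LC.sum le_rfl _ fun j _ => LC.det1 hN (fun i j => LC_dd_1 hN hu hus hc hρ _ _)
    (LC_d_1 hN hu hus hc hρ _) (g := fun x => gp φ j x) (fun l => ?_) j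
  obtain ⟨C, hC⟩ := gp_bdd hφ hφs j l
  exact memLp_top_of_bound (cont_pd2 hφ j l).aestronglyMeasurable C (Eventually.of_forall hC)

lemma LC_F2 (hN : 3 ≤ N) (hu : ∀ k, ContDiff ℝ 2 (u k)) (hus : ∀ k, HasCompactSupport (u k))
    (hc : Cau u) (hρ : WW ρ) (hφ : ContDiff ℝ 2 φ) (hφs : HasCompactSupport φ) :
    LC 1 (tmeas N) (fun n p => F2 (MW ρ (u n)) φ p) := by
  have hg : ∀ j l, MemLp (fun p : Eu N × ℝ => gp φ j p.1 l) ⊤ (tmeas N) := by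
    intro j l
    obtain ⟨C, hC⟩ := gp_bdd hφ hφs j l
    exact memLp_top_of_bound (cont_gp hφ j l).aestronglyMeasurable C
      (Eventually.of_forall fun p => hC p.1)
  unfold F2
  refine LC.sub le_rfl (LC.sum le_rfl _ fun j _ => ?_)
    (LC.sum le_rfl _ fun j _ => LC.sum le_rfl _ fun i hi => ?_)
  · exact LC.det1 hN (fun i j => LC_dd_t hN hu hus hc hρ _ _) (LC_dd_t hN hu hus hc hρ _ _)
      (g := fun p : Eu N × ℝ => gp φ j p.1) (hg j) j
  · exact LC.det2 hN (fun i j => LC_dd_t hN hu hus hc hρ _ _) (LC_dd_t hN hu hus hc hρ _ _)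
      (g := fun p : Eu N × ℝ => gp φ j p.1) (hg j) (fun l => LC_dd_t hN hu hus hc hρ _ _) i j
      (Finset.ne_of_mem_erase hi)

lemma int_tmeas {F : Eu N × ℝ → ℝ} (hF : Integrable F (tmeas N)) :
    ∫ p, F p ∂(tmeas N) = ∫ t in (0:ℝ)..1, t * ∫ x, F (x, t) := by
  have hm : Measurable (fun p : Eu N × ℝ => ENNReal.ofReal p.2) := by fun_prop
  unfold tmeas at hF ⊢
  rw [integrable_withDensity_iff_integrable_smul' hm (by simp)] at hF
  rw [integral_withDensity_eq_integral_toReal_smul hm (by simp), integral_prod_symm _ hF,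
    intervalIntegral.integral_of_le zero_le_one]
  apply setIntegral_congr_fun measurableSet_Ioc
  intro t ht
  simp only [smul_eq_mul, ENNReal.toReal_ofReal ht.1.le]
  rw [integral_const_mul]

theorem main_aux (hN : 3 ≤ N) (hu : ∀ k, ContDiff ℝ 2 (u k)) (hus : ∀ k, HasCompactSupport (u k))
    (hc : Cau u) (hφ : ContDiff ℝ 2 φ) (hφs : HasCompactSupport φ) :
    ∃ L : ℝ, Tendsto (fun k => ∫ x : Eu N, hessDet (u k) x * φ x) atTop (𝓝 L) := by
  obtain ⟨ρ, hρ, h1⟩ := exists_WW (N := N)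
  have h2 := LC_F2 hN hu hus hc hρ hφ hφs
  obtain ⟨L0, hL0⟩ := (LC_F0 hN hu hus hc hρ hφ hφs).integral
  obtain ⟨L1, hL1⟩ := (LC_F1 hN hu hus hc hρ hφ hφs).integral
  obtain ⟨L2, hL2⟩ := h2.integral
  refine ⟨L0 - L1 + L2, ((hL0.sub hL1).add hL2).congr fun k => ?_⟩
  rw [int_tmeas (memLp_one_iff_integrable.1 (h2.1 k)),
    ← ident (MW_smooth hρ (hu k).continuous) hφ hφs (cont_dd1 hρ (hu k) (hus k) et)
      (cont_dd2 hρ (hu k) (hus k))]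
  simp only [F0_zero_eq hρ h1 (hu k) (hus k)]

end fin

end part9

/-- Corollary: if `(u k)` is Cauchy in the `B(2-2/N, N)` norm, then the distributional
Hessian determinants converge when tested against any `φ ∈ C²_c`. -/
theorem stmt1 (N : ℕ) (hN : 3 ≤ N) (u : ℕ → Eu N → ℝ)
    (hu : ∀ k, ContDiff ℝ 2 (u k)) (hus : ∀ k, HasCompactSupport (u k))
    (hcauchy : ∀ ε : ℝ, 0 < ε → ∃ M : ℕ, ∀ m n : ℕ, M ≤ m → M ≤ n →
      besov N (2 - 2/(N:ℝ)) N (fun x => u m x - u n x) < ε)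
    (φ : Eu N → ℝ) (hφ : ContDiff ℝ 2 φ) (hφs : HasCompactSupport φ) :
    ∃ L : ℝ, Tendsto (fun k => ∫ x : Eu N, hessDet (u k) x * φ x) atTop (nhds L) := by
  exact main_aux hN hu hus hcauchy hφ hφs
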